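/- Let Γ be a subgroup of Diff^ω₊(S¹) which is nondiscrete with respect to the C¹-topology and which preserves no Borel probability measure on the circle. Then there exists a nowhere zero continuous vector field defined on some open interval in S¹ which is in the C⁰-closure of Γ relative to that interval. -/

import Mathlib

open Filter Topology Set MeasureTheory Classical

noncomputable section

/-- The circle `S¹ = ℝ/ℤ`. -/
abbrev S1 := AddCircle (1 : ℝ)

/-- The group of homeomorphisms of the circle (composition as multiplication). -/
instance : Group (S1 ≃ₜ S1) where
  mul f g := g.trans f
  one := Homeomorph.refl _
  inv := Homeomorph.symm
  mul_assoc f g h := rfl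
  one_mul f := Homeomorph.ext fun _ => rfl
  mul_one f := Homeomorph.ext fun _ => rfl
  inv_mul_cancel f := Homeomorph.ext fun x => f.symm_apply_apply x

/-- `F` is a lift of the circle map `f` to the real line. -/
def IsLiftOf (F : CircleDeg1Lift) (f : S1 ≃ₜ S1) : Prop :=
  ∀ x : ℝ, f (x : S1) = ((F x : ℝ) : S1)

/-- `f` is an orientation-preserving homeomorphism of the circle: it admits a lift to
a monotone homeomorphism of `ℝ` commuting with integer translations. -/
def OrientationPreserving (f : S1 ≃ₜ S1) : Prop :=
  ∃ F : CircleDeg1Liftˣ, IsLiftOf (F : CircleDeg1Lift) f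

/-- The rotation number `ρ(f) ∈ ℝ/ℤ` of an orientation-preserving circle homeomorphism:
the translation number of a lift, taken modulo `ℤ` (independent of the lift). -/
def rotationNumber (f : S1 ≃ₜ S1) : AddCircle (1 : ℝ) :=
  if h : ∃ F : CircleDeg1Liftˣ, IsLiftOf (F : CircleDeg1Lift) f then
    (((h.choose : CircleDeg1Lift).translationNumber : ℝ) : AddCircle (1 : ℝ))
  else 0

/-- The orbit of `x` under a subgroup `Γ` of circle homeomorphisms. -/
def circleOrbit (Γ : Subgroup (S1 ≃ₜ S1)) (x : S1) : Set S1 :=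
  {y : S1 | ∃ γ ∈ Γ, γ x = y}

/-- `Γ` has a finite orbit. -/
def HasFiniteOrbit (Γ : Subgroup (S1 ≃ₜ S1)) : Prop :=
  ∃ x : S1, (circleOrbit Γ x).Finite

/-- `f` is an orientation-preserving real analytic diffeomorphism of the circle: it has a
lift which is a real analytic map `ℝ → ℝ` with everywhere positive derivative. -/
def IsAnalyticDiffeo (f : S1 ≃ₜ S1) : Prop :=
  ∃ F : CircleDeg1Liftˣ, IsLiftOf (F : CircleDeg1Lift) f ∧
    AnalyticOnNhd ℝ (⇑(F : CircleDeg1Lift)) Set.univ ∧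
    ∀ x : ℝ, 0 < deriv (⇑(F : CircleDeg1Lift)) x

/-- `Γ` is nondiscrete with respect to the `C¹`-topology: there is a sequence of elements of
`Γ ∖ {id}` converging to the identity in the `C¹`-topology (expressed via lifts). -/
def C1Nondiscrete (Γ : Subgroup (S1 ≃ₜ S1)) : Prop :=
  ∃ (f : ℕ → S1 ≃ₜ S1) (F : ℕ → CircleDeg1Liftˣ),
    (∀ n, f n ∈ Γ ∧ f n ≠ 1 ∧ IsLiftOf (F n : CircleDeg1Lift) (f n)) ∧
    ∀ ε : ℝ, 0 < ε → ∃ N : ℕ, ∀ n ≥ N, ∀ x : ℝ,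
      |(F n : CircleDeg1Lift) x - x| < ε ∧ |deriv (⇑(F n : CircleDeg1Lift)) x - 1| < ε

/-- `Γ` is locally nondiscrete with respect to the `C¹`-topology: some sequence of elements of
`Γ ∖ {id}` converges to the identity in the `C¹`-topology on some open interval of the circle
(an interval is described by a lift chart `]a, b[` with `b ≤ a + 1`). -/
def LocallyC1Nondiscrete (Γ : Subgroup (S1 ≃ₜ S1)) : Prop :=
  ∃ a b : ℝ, a < b ∧ b ≤ a + 1 ∧
    ∃ (f : ℕ → S1 ≃ₜ S1) (F : ℕ → CircleDeg1Liftˣ),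
      (∀ n, f n ∈ Γ ∧ f n ≠ 1 ∧ IsLiftOf (F n : CircleDeg1Lift) (f n)) ∧
      ∀ ε : ℝ, 0 < ε → ∃ N : ℕ, ∀ n ≥ N, ∀ x ∈ Ioo a b,
        |(F n : CircleDeg1Lift) x - x| < ε ∧ |deriv (⇑(F n : CircleDeg1Lift)) x - 1| < ε

/-- `Γ` is locally nondiscrete with respect to the `C⁰`-topology. -/
def LocallyC0Nondiscrete (Γ : Subgroup (S1 ≃ₜ S1)) : Prop :=
  ∃ a b : ℝ, a < b ∧ b ≤ a + 1 ∧
    ∃ (f : ℕ → S1 ≃ₜ S1) (F : ℕ → CircleDeg1Liftˣ),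
      (∀ n, f n ∈ Γ ∧ f n ≠ 1 ∧ IsLiftOf (F n : CircleDeg1Lift) (f n)) ∧
      ∀ ε : ℝ, 0 < ε → ∃ N : ℕ, ∀ n ≥ N, ∀ x ∈ Ioo a b,
        |(F n : CircleDeg1Lift) x - x| < ε

/-- There is a `Γ`-invariant Borel probability measure on the circle. -/
def HasInvariantProbMeasure (Γ : Subgroup (S1 ≃ₜ S1)) : Prop :=
  ∃ μ : Measure S1, IsProbabilityMeasure μ ∧ ∀ γ ∈ Γ, Measure.map (⇑γ) μ = μ

/-- `Γ` is minimal: every orbit is dense in the circle. -/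
def IsMinimalSubgroup (Γ : Subgroup (S1 ≃ₜ S1)) : Prop :=
  ∀ x : S1, Dense (circleOrbit Γ x)

/-- The closed arc `π([a, b])` of the circle. -/
def closedArc (a b : ℝ) : Set S1 :=
  (fun x : ℝ => (x : S1)) '' Icc a b

/-- The closed arc `π([a,b])` is `Γ`-contractible: some sequence `gₙ ∈ Γ` shrinks its
length to zero (lengths are measured via orientation-preserving lifts). -/
def ContractibleArc (Γ : Subgroup (S1 ≃ₜ S1)) (a b : ℝ) : Prop :=
  ∃ (g : ℕ → S1 ≃ₜ S1) (G : ℕ → CircleDeg1Liftˣ),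
    (∀ n, g n ∈ Γ ∧ IsLiftOf (G n : CircleDeg1Lift) (g n)) ∧
    Tendsto (fun n => (G n : CircleDeg1Lift) b - (G n : CircleDeg1Lift) a) atTop (𝓝 0)

/-- `Φ` is a local flow of the vector field `X` on the set `K` for times `0 ≤ t ≤ t₀`,
staying inside the domain `dom` of `X`. -/
def IsLocalFlowOn (X : ℝ → ℝ) (dom : Set ℝ) (Φ : ℝ → ℝ → ℝ) (K : Set ℝ) (t₀ : ℝ) : Prop :=
  (∀ x ∈ K, Φ 0 x = x) ∧
  ∀ x ∈ K, ∀ t ∈ Icc (0 : ℝ) t₀, Φ t x ∈ dom ∧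
    HasDerivWithinAt (fun s => Φ s x) (X (Φ t x)) (Icc (0 : ℝ) t₀) t

/-- The local vector field `X` on the open interval `]a,b[` (in a lift chart of the circle)
is in the `C⁰`-closure of `Γ` relative to this interval: every time-`t₀` map of its local flow
defined on a compact subinterval is a uniform limit of (lifts of) elements of `Γ`. -/
def InC0Closure (Γ : Subgroup (S1 ≃ₜ S1)) (a b : ℝ) (X : ℝ → ℝ) : Prop :=
  ∀ c d : ℝ, a < c → c ≤ d → d < b →
    ∀ t₀ : ℝ, 0 < t₀ → ∀ Φ : ℝ → ℝ → ℝ,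
      IsLocalFlowOn X (Ioo a b) Φ (Icc c d) t₀ →
      ∃ (γ : ℕ → S1 ≃ₜ S1) (G : ℕ → CircleDeg1Liftˣ),
        (∀ n, γ n ∈ Γ ∧ IsLiftOf (G n : CircleDeg1Lift) (γ n)) ∧
        TendstoUniformlyOn (fun n x => (G n : CircleDeg1Lift) x) (fun x => Φ t₀ x)
          atTop (Icc c d)


/-! ### Part A: units of `CircleDeg1Lift` without ping-pong have additive translation numbers -/

lemma cu_strictMono (F : CircleDeg1Liftˣ) : StrictMono (F : CircleDeg1Lift) := by
  have := (CircleDeg1Lift.toOrderIso F).strictMono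
  rwa [CircleDeg1Lift.coe_toOrderIso] at this

lemma cu_continuous (F : CircleDeg1Liftˣ) : Continuous (F : CircleDeg1Lift) := by
  have := (CircleDeg1Lift.toOrderIso F).continuous
  rwa [CircleDeg1Lift.coe_toOrderIso] at this

lemma cu_mul (F G : CircleDeg1Liftˣ) (x : ℝ) : (F * G) x = F (G x) := rfl

lemma cu_fix_or_lt (c : CircleDeg1Liftˣ) (h : ∃ x, c x ≤ x) :
    (∃ x, c x = x) ∨ ∀ x, c x < x := by
  by_cases h2 : ∀ x, c x < x
  · exact Or.inr h2
  · left
    push Not at h2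
    obtain ⟨x, hx⟩ := h
    obtain ⟨y, hy⟩ := h2
    have hc : Continuous (fun t => c t - t) := (cu_continuous c).sub continuous_id
    have := mem_range_of_exists_le_of_exists_ge hc (c := 0) ⟨x, by simpa using hx⟩
      ⟨y, by simpa using hy⟩
    obtain ⟨z, hz⟩ := this
    exact ⟨z, by simpa [sub_eq_zero] using hz⟩

def CommonFix (G : Subgroup CircleDeg1Liftˣ) : Prop :=
  ∀ f ∈ G, ∀ g ∈ G, (∃ x, f x = x) → (∃ x, g x = x) → ∃ x, f x = x ∧ g x = x

def NonPos (c : CircleDeg1Liftˣ) : Prop := ∃ x, c x ≤ x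

lemma nonPos_mul {G : Subgroup CircleDeg1Liftˣ} (hG : CommonFix G) {c d : CircleDeg1Liftˣ}
    (hc : c ∈ G) (hd : d ∈ G) (h1 : NonPos c) (h2 : NonPos d) : NonPos (c * d) := by
  rcases cu_fix_or_lt c h1 with h | h
  · rcases cu_fix_or_lt d h2 with h' | h'
    · obtain ⟨x, hx, hx'⟩ := hG c hc d hd h h'
      exact ⟨x, by rw [cu_mul, hx', hx]⟩
    · obtain ⟨x, hx⟩ := h1
      refine ⟨x, ?_⟩
      rw [cu_mul]
      exact ((cu_strictMono c).monotone (h' x).le).trans hx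
  · obtain ⟨x, hx⟩ := h2
    exact ⟨x, (h _).le.trans hx⟩

lemma nonPos_conj {c : CircleDeg1Liftˣ} (h : NonPos c) (g : CircleDeg1Liftˣ) :
    NonPos (g⁻¹ * c * g) := by
  obtain ⟨x, hx⟩ := h
  refine ⟨g⁻¹ x, ?_⟩
  rw [cu_mul, cu_mul, CircleDeg1Lift.units_apply_inv_apply]
  exact (cu_strictMono _).monotone hx

def Pre (x y : CircleDeg1Liftˣ) : Prop := NonPos (y⁻¹ * x)

lemma Pre.mul_left {x y : CircleDeg1Liftˣ} (h : Pre x y) (g : CircleDeg1Liftˣ) :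
    Pre (g * x) (g * y) := by
  unfold Pre at *
  convert h using 1; group

lemma Pre.mul_right {x y : CircleDeg1Liftˣ} (h : Pre x y) (g : CircleDeg1Liftˣ) :
    Pre (x * g) (y * g) := by
  unfold Pre at *
  convert nonPos_conj h g using 1; group

lemma Pre.trans {G : Subgroup CircleDeg1Liftˣ} (hG : CommonFix G) {x y z : CircleDeg1Liftˣ}
    (hx : x ∈ G) (hy : y ∈ G) (hz : z ∈ G) (h : Pre x y) (h' : Pre y z) : Pre x z := by
  have := nonPos_mul hG (G.mul_mem (G.inv_mem hz) hy) (G.mul_mem (G.inv_mem hy) hx) h' h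
  unfold Pre
  convert this using 1; group

lemma Pre.refl (x : CircleDeg1Liftˣ) : Pre x x := ⟨0, by simp⟩

lemma Pre.pow {G : Subgroup CircleDeg1Liftˣ} (hG : CommonFix G) {x y : CircleDeg1Liftˣ}
    (hx : x ∈ G) (hy : y ∈ G) (h : Pre x y) (n : ℕ) : Pre (x ^ n) (y ^ n) := by
  induction n with
  | zero => simpa using Pre.refl 1
  | succ n ih =>
    rw [pow_succ, pow_succ]
    exact Pre.trans hG (G.mul_mem (G.pow_mem hx n) hx) (G.mul_mem (G.pow_mem hy n) hx)
      (G.mul_mem (G.pow_mem hy n) hy) (ih.mul_right x) (h.mul_left _)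

lemma cu_tau_upper (f : CircleDeg1Liftˣ) (x : ℝ) :
    f x < x + CircleDeg1Lift.translationNumber f + 1 :=
  CircleDeg1Lift.map_lt_add_translationNumber_add_one _ _

lemma cu_tau_lower (f : CircleDeg1Liftˣ) (x : ℝ) :
    x + CircleDeg1Lift.translationNumber f - 1 < f x := by
  have h1 := CircleDeg1Lift.translationNumber_le_ceil_sub (f : CircleDeg1Lift) x
  have h2 := Int.ceil_lt_add_one (f x - x)
  linarith

lemma le_of_forall_nat_mul_le {a b C : ℝ} (h : ∀ n : ℕ, n * a ≤ n * b + C) : a ≤ b := by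
  by_contra hab
  push Not at hab
  obtain ⟨n, hn⟩ := exists_nat_gt (C / (a - b))
  have := h n
  rw [div_lt_iff₀ (by linarith)] at hn
  linarith

lemma cu_tau_pow (f : CircleDeg1Liftˣ) (n : ℕ) :
    CircleDeg1Lift.translationNumber ((f ^ n : CircleDeg1Liftˣ) : CircleDeg1Lift)
      = n * CircleDeg1Lift.translationNumber f := by
  rw [Units.val_pow_eq_pow_val, CircleDeg1Lift.translationNumber_pow]

lemma Pre.tau_le {G : Subgroup CircleDeg1Liftˣ} (hG : CommonFix G) {x y : CircleDeg1Liftˣ}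
    (hx : x ∈ G) (hy : y ∈ G) (h : Pre x y) :
    CircleDeg1Lift.translationNumber x ≤ CircleDeg1Lift.translationNumber y := by
  apply le_of_forall_nat_mul_le (C := 2)
  intro n
  obtain ⟨p, hp⟩ := h.pow hG hx hy n
  rw [cu_mul] at hp
  have h3 := (cu_strictMono (y ^ n)).monotone hp
  rw [CircleDeg1Lift.units_apply_inv_apply] at h3
  have h1 := cu_tau_lower (x ^ n) p
  have h2 := cu_tau_upper (y ^ n) p
  rw [cu_tau_pow] at h1 h2
  linarith

lemma cu_tau_mul_comm (a b : CircleDeg1Liftˣ) :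
    CircleDeg1Lift.translationNumber ((a * b : CircleDeg1Liftˣ) : CircleDeg1Lift)
      = CircleDeg1Lift.translationNumber ((b * a : CircleDeg1Liftˣ) : CircleDeg1Lift) := by
  have := CircleDeg1Lift.translationNumber_conj_eq a ((b * a : CircleDeg1Liftˣ) : CircleDeg1Lift)
  rw [← this]
  congr 1
  rw [← Units.val_mul, ← Units.val_mul]
  congr 1
  group

lemma cu_tau_mul_near (a b : CircleDeg1Liftˣ) :
    |CircleDeg1Lift.translationNumber ((a * b : CircleDeg1Liftˣ) : CircleDeg1Lift)
      - CircleDeg1Lift.translationNumber a - CircleDeg1Lift.translationNumber b| ≤ 3 := by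
  have h1 := cu_tau_upper (a * b) 0
  have h2 := cu_tau_lower (a * b) 0
  have h3 := cu_tau_upper a (b 0)
  have h4 := cu_tau_lower a (b 0)
  have h5 := cu_tau_upper b 0
  have h6 := cu_tau_lower b 0
  rw [cu_mul] at h1 h2
  rw [abs_le]; constructor <;> linarith

lemma tau_additive_aux {G : Subgroup CircleDeg1Liftˣ} (hG : CommonFix G) {a b : CircleDeg1Liftˣ}
    (ha : a ∈ G) (hb : b ∈ G) (h : Pre (a * b) (b * a)) :
    CircleDeg1Lift.translationNumber ((a * b : CircleDeg1Liftˣ) : CircleDeg1Lift)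
      = CircleDeg1Lift.translationNumber a + CircleDeg1Lift.translationNumber b := by
  have hab := G.mul_mem ha hb
  have A : ∀ n : ℕ, Pre (a ^ n * b) (b * a ^ n) := by
    intro n
    induction n with
    | zero => simpa using Pre.refl b
    | succ n ih =>
      have e1 := h.mul_left (a ^ n)
      have e2 := ih.mul_right a
      have := Pre.trans hG (x := a ^ n * (a * b)) (y := a ^ n * (b * a)) (z := b * a ^ n * a)
        (G.mul_mem (G.pow_mem ha n) hab) (G.mul_mem (G.pow_mem ha n) (G.mul_mem hb ha))
        (G.mul_mem (G.mul_mem hb (G.pow_mem ha n)) ha) e1 (by simpa [mul_assoc] using e2)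
      simpa [pow_succ, mul_assoc] using this
  have B1 : ∀ n : ℕ, Pre ((a * b) ^ n) (b ^ n * a ^ n) := by
    intro n
    induction n with
    | zero => simpa using Pre.refl 1
    | succ n ih =>
      have e1 := ih.mul_right (a * b)
      have e2 := (A (n + 1)).mul_left (b ^ n)
      have := Pre.trans hG (x := (a * b) ^ n * (a * b)) (y := b ^ n * a ^ n * (a * b))
        (z := b ^ n * (b * a ^ (n + 1)))
        (G.mul_mem (G.pow_mem hab n) hab)
        (G.mul_mem (G.mul_mem (G.pow_mem hb n) (G.pow_mem ha n)) hab)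
        (G.mul_mem (G.pow_mem hb n) (G.mul_mem hb (G.pow_mem ha _)))
        e1 (by simpa [mul_assoc, pow_succ] using e2)
      simpa [pow_succ, mul_assoc] using this
  have B2 : ∀ n : ℕ, Pre (a ^ n * b ^ n) ((a * b) ^ n) := by
    intro n
    induction n with
    | zero => simpa using Pre.refl 1
    | succ n ih =>
      have e1 := ih.mul_left (a * b)
      have e2 := ((A n).mul_left a).mul_right (b ^ n)
      have := Pre.trans hG (x := a * (a ^ n * b) * b ^ n) (y := a * (b * a ^ n) * b ^ n)
        (z := (a * b) * (a * b) ^ n)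
        (G.mul_mem (G.mul_mem ha (G.mul_mem (G.pow_mem ha n) hb)) (G.pow_mem hb n))
        (G.mul_mem (G.mul_mem ha (G.mul_mem hb (G.pow_mem ha n))) (G.pow_mem hb n))
        (G.mul_mem hab (G.pow_mem hab n))
        e2 (by simpa [mul_assoc] using e1)
      simpa [pow_succ', mul_assoc] using this
  have key : ∀ n : ℕ, CircleDeg1Lift.translationNumber ((a ^ n * b ^ n : CircleDeg1Liftˣ) :
      CircleDeg1Lift) = n * CircleDeg1Lift.translationNumber
        ((a * b : CircleDeg1Liftˣ) : CircleDeg1Lift) := by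
    intro n
    rw [← cu_tau_pow]
    apply le_antisymm
    · exact (B2 n).tau_le hG (G.mul_mem (G.pow_mem ha n) (G.pow_mem hb n)) (G.pow_mem hab n)
    · rw [cu_tau_mul_comm]
      exact (B1 n).tau_le hG (G.pow_mem hab n) (G.mul_mem (G.pow_mem hb n) (G.pow_mem ha n))
  apply le_antisymm
  · apply le_of_forall_nat_mul_le (C := 3)
    intro n
    have := cu_tau_mul_near (a ^ n) (b ^ n)
    rw [key, cu_tau_pow, cu_tau_pow, abs_le] at this
    linarith
  · apply le_of_forall_nat_mul_le (C := 3)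
    intro n
    have := cu_tau_mul_near (a ^ n) (b ^ n)
    rw [key, cu_tau_pow, cu_tau_pow, abs_le] at this
    linarith

lemma tau_additive {G : Subgroup CircleDeg1Liftˣ} (hG : CommonFix G) {a b : CircleDeg1Liftˣ}
    (ha : a ∈ G) (hb : b ∈ G) :
    CircleDeg1Lift.translationNumber ((a * b : CircleDeg1Liftˣ) : CircleDeg1Lift)
      = CircleDeg1Lift.translationNumber a + CircleDeg1Lift.translationNumber b := by
  by_cases h : Pre (a * b) (b * a)
  · exact tau_additive_aux hG ha hb h
  · have h' : Pre (b * a) (a * b) := by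
      unfold Pre NonPos at h
      push Not at h
      refine ⟨0, ?_⟩
      have h1 := h ((a * b)⁻¹ * (b * a) |>.1 0)
      rw [← cu_mul] at h1
      have h2 : (b * a)⁻¹ * (a * b) * ((a * b)⁻¹ * (b * a)) = 1 := by group
      rw [h2] at h1
      simpa using h1.le
    rw [cu_tau_mul_comm, tau_additive_aux hG hb ha h', add_comm]
/-! ### Invariant measure from additivity of the translation number -/

def liftGroup (Γ : Subgroup (S1 ≃ₜ S1)) : Subgroup CircleDeg1Liftˣ where
  carrier := {F | ∃ f ∈ Γ, IsLiftOf (F : CircleDeg1Lift) f}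
  mul_mem' := by
    rintro F G ⟨f, hf, hF⟩ ⟨g, hg, hG⟩
    refine ⟨f * g, Γ.mul_mem hf hg, fun x => ?_⟩
    change f (g x) = _
    rw [hG, hF]; rfl
  one_mem' := ⟨1, Γ.one_mem, fun x => rfl⟩
  inv_mem' := by
    rintro F ⟨f, hf, hF⟩
    refine ⟨f⁻¹, Γ.inv_mem hf, fun x => ?_⟩
    change f.symm x = _
    rw [Homeomorph.symm_apply_eq, hF, CircleDeg1Lift.units_apply_inv_apply]

lemma translate_mem_liftGroup (Γ : Subgroup (S1 ≃ₜ S1)) (n : ℤ) :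
    CircleDeg1Lift.translate (Multiplicative.ofAdd (n : ℝ)) ∈ liftGroup Γ := by
  refine ⟨1, Γ.one_mem, fun x => ?_⟩
  rw [CircleDeg1Lift.translate_apply, AddCircle.coe_add]
  have : ((n : ℝ) : S1) = 0 := by
    rw [AddCircle.coe_eq_zero_iff]; exact ⟨n, by simp⟩
  rw [this, zero_add]; rfl

def heightSet (G : Subgroup CircleDeg1Liftˣ) (y : ℝ) : Set ℝ :=
  {t | ∃ γ ∈ G, γ 0 ≤ y ∧ t = CircleDeg1Lift.translationNumber γ}

def height (G : Subgroup CircleDeg1Liftˣ) (y : ℝ) : ℝ := sSup (heightSet G y)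

lemma heightSet_bdd (G : Subgroup CircleDeg1Liftˣ) (y : ℝ) : BddAbove (heightSet G y) := by
  refine ⟨y + 1, ?_⟩
  rintro t ⟨γ, -, h, rfl⟩
  have := cu_tau_lower γ 0
  linarith

lemma heightSet_nonempty (Γ : Subgroup (S1 ≃ₜ S1)) (y : ℝ) :
    (heightSet (liftGroup Γ) y).Nonempty := by
  refine ⟨_, _, translate_mem_liftGroup Γ ⌊y⌋, ?_, rfl⟩
  rw [CircleDeg1Lift.translate_apply]
  simpa using Int.floor_le y

lemma height_mono (Γ : Subgroup (S1 ≃ₜ S1)) : Monotone (height (liftGroup Γ)) := by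
  intro x y h
  apply csSup_le_csSup (heightSet_bdd _ _) (heightSet_nonempty _ _)
  rintro t ⟨γ, h1, h2, h3⟩
  exact ⟨γ, h1, h2.trans h, h3⟩

lemma height_le_equivariant (Γ : Subgroup (S1 ≃ₜ S1)) (hG : CommonFix (liftGroup Γ))
    {γ : CircleDeg1Liftˣ} (hγ : γ ∈ liftGroup Γ) (y : ℝ) :
    height (liftGroup Γ) y + CircleDeg1Lift.translationNumber γ ≤ height (liftGroup Γ) (γ y) := by
  rw [← le_sub_iff_add_le]
  apply csSup_le (heightSet_nonempty _ _)
  rintro t ⟨δ, hδ, h, rfl⟩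
  rw [le_sub_iff_add_le]
  apply le_csSup (heightSet_bdd _ _)
  refine ⟨γ * δ, mul_mem hγ hδ, ?_, ?_⟩
  · rw [cu_mul]; exact (cu_strictMono γ).monotone h
  · rw [tau_additive hG hγ hδ, add_comm]

lemma height_equivariant (Γ : Subgroup (S1 ≃ₜ S1)) (hG : CommonFix (liftGroup Γ))
    {γ : CircleDeg1Liftˣ} (hγ : γ ∈ liftGroup Γ) (y : ℝ) :
    height (liftGroup Γ) (γ y) = height (liftGroup Γ) y + CircleDeg1Lift.translationNumber γ := by
  apply le_antisymm _ (height_le_equivariant Γ hG hγ y)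
  have := height_le_equivariant Γ hG (inv_mem hγ) (γ y)
  rw [CircleDeg1Lift.units_inv_apply_apply, CircleDeg1Lift.translationNumber_units_inv] at this
  linarith

def heightS (Γ : Subgroup (S1 ≃ₜ S1)) : StieltjesFunction ℝ := (height_mono Γ).stieltjesFunction

lemma heightS_equivariant (Γ : Subgroup (S1 ≃ₜ S1)) (hG : CommonFix (liftGroup Γ))
    {γ : CircleDeg1Liftˣ} (hγ : γ ∈ liftGroup Γ) (y : ℝ) :
    heightS Γ (γ y) = heightS Γ y + CircleDeg1Lift.translationNumber γ := by
  unfold heightS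
  rw [Monotone.stieltjesFunction_eq, Monotone.stieltjesFunction_eq]
  have h1 := (height_mono Γ).tendsto_rightLim y
  have h2 := (height_mono Γ).tendsto_rightLim (γ y)
  have h3 : Tendsto (fun x => γ x) (𝓝[>] y) (𝓝[>] (γ y)) := by
    apply tendsto_nhdsWithin_of_tendsto_nhds_of_eventually_within
    · exact ((cu_continuous γ).tendsto y).mono_left nhdsWithin_le_nhds
    · filter_upwards [self_mem_nhdsWithin] with x hx
      exact cu_strictMono γ hx
  have h4 := h2.comp h3
  have h5 := h1.add_const (CircleDeg1Lift.translationNumber (γ : CircleDeg1Lift))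
  apply tendsto_nhds_unique h4
  refine h5.congr (fun x => ?_)
  simp only [Function.comp]
  rw [height_equivariant Γ hG hγ]

lemma cu_preimage_Ioc (γ : CircleDeg1Liftˣ) (a b : ℝ) :
    (fun x => γ x) ⁻¹' Ioc (γ a) (γ b) = Ioc a b := by
  ext x
  simp [(cu_strictMono γ).lt_iff_lt, (cu_strictMono γ).le_iff_le]

lemma heightS_invariant (Γ : Subgroup (S1 ≃ₜ S1)) (hG : CommonFix (liftGroup Γ))
    {γ : CircleDeg1Liftˣ} (hγ : γ ∈ liftGroup Γ) :
    Measure.map (fun x => γ x) (heightS Γ).measure = (heightS Γ).measure := by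
  symm
  apply Measure.ext_of_Ioc
  intro a b _
  rw [Measure.map_apply (cu_continuous γ).measurable measurableSet_Ioc]
  have ha : a = γ (γ⁻¹ a) := (CircleDeg1Lift.units_apply_inv_apply γ a).symm
  have hb : b = γ (γ⁻¹ b) := (CircleDeg1Lift.units_apply_inv_apply γ b).symm
  conv_rhs => rw [ha, hb]
  rw [cu_preimage_Ioc, StieltjesFunction.measure_Ioc, StieltjesFunction.measure_Ioc]
  conv_lhs => rw [ha, hb, heightS_equivariant Γ hG hγ, heightS_equivariant Γ hG hγ]
  simp

lemma heightS_periodic (Γ : Subgroup (S1 ≃ₜ S1)) (hG : CommonFix (liftGroup Γ)) {A : Set ℝ}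
    (hA : MeasurableSet A) (hA' : ∀ n : ℤ, (fun x => (n : ℝ) + x) ⁻¹' A = A) (s t : ℝ) :
    (heightS Γ).measure (A ∩ Ioc s (s + 1)) = (heightS Γ).measure (A ∩ Ioc t (t + 1)) := by
  have hinv : ∀ n : ℤ, ∀ B : Set ℝ, MeasurableSet B →
      (heightS Γ).measure ((fun x => (n : ℝ) + x) ⁻¹' B) = (heightS Γ).measure B := by
    intro n B hB
    have := heightS_invariant Γ hG (translate_mem_liftGroup Γ n)
    conv_rhs => rw [← this]
    rw [Measure.map_apply (cu_continuous _).measurable hB]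
    rfl
  have : VAddInvariantMeasure (AddSubgroup.zmultiples (1 : ℝ)) ℝ (heightS Γ).measure := by
    refine ⟨?_⟩
    rintro ⟨c, n, rfl⟩ B hB
    have := hinv n B hB
    simpa [AddSubgroup.vadd_def] using this
  refine (isAddFundamentalDomain_Ioc one_pos s _).measure_set_eq
    (isAddFundamentalDomain_Ioc one_pos t _) hA ?_
  rintro ⟨c, n, rfl⟩
  simpa [AddSubgroup.vadd_def] using hA' n

lemma coe_int_add (n : ℤ) (x : ℝ) : (((n : ℝ) + x : ℝ) : S1) = (x : S1) := by
  rw [AddCircle.coe_add]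
  have : ((n : ℝ) : S1) = 0 := by
    rw [AddCircle.coe_eq_zero_iff]; exact ⟨n, by simp⟩
  rw [this, zero_add]

lemma hasInvariantProbMeasure_of_commonFix (Γ : Subgroup (S1 ≃ₜ S1))
    (hlift : ∀ f ∈ Γ, ∃ F : CircleDeg1Liftˣ, IsLiftOf (F : CircleDeg1Lift) f)
    (hG : CommonFix (liftGroup Γ)) : HasInvariantProbMeasure Γ := by
  have hpi : Measurable (fun x : ℝ => (x : S1)) := AddCircle.measurable_mk'
  have hT : (heightS Γ) (0 + 1) = heightS Γ 0 + 1 := by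
    have h := heightS_equivariant Γ hG (translate_mem_liftGroup Γ 1) 0
    rw [CircleDeg1Lift.translate_apply, CircleDeg1Lift.translationNumber_translate] at h
    simpa using h
  refine ⟨Measure.map (fun x : ℝ => (x : S1)) ((heightS Γ).measure.restrict (Ioc 0 (0 + 1))),
    ⟨?_⟩, ?_⟩
  · rw [Measure.map_apply hpi MeasurableSet.univ]
    simp only [preimage_univ, Measure.restrict_apply_univ, StieltjesFunction.measure_Ioc]
    rw [hT]; simp
  · intro f hf
    obtain ⟨F, hF⟩ := hlift f hf
    have hFm : F ∈ liftGroup Γ := ⟨f, hf, hF⟩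
    have hfm : Measurable f := f.continuous.measurable
    ext A hA
    rw [Measure.map_apply hfm hA, Measure.map_apply hpi (hfm hA), Measure.map_apply hpi hA,
      Measure.restrict_apply (hpi (hfm hA)), Measure.restrict_apply (hpi hA)]
    have e1 : (fun x : ℝ => (x : S1)) ⁻¹' (f ⁻¹' A) ∩ Ioc 0 (0 + 1)
        = (fun x => F x) ⁻¹' ((fun x : ℝ => (x : S1)) ⁻¹' A ∩ Ioc (F 0) (F 0 + 1)) := by
      rw [preimage_inter, ← CircleDeg1Lift.map_add_one, cu_preimage_Ioc]
      congr 1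
      ext x
      simp only [mem_preimage]
      rw [hF x]
    rw [e1, ← Measure.map_apply (cu_continuous F).measurable ((hpi hA).inter measurableSet_Ioc),
      heightS_invariant Γ hG hFm]
    apply heightS_periodic Γ hG (hpi hA)
    intro n
    ext x
    simp only [mem_preimage]
    rw [coe_int_add]
/-! ### Part B: ping-pong and hyperbolic fixed points -/

lemma cu_pow_apply (F : CircleDeg1Liftˣ) (n : ℕ) (x : ℝ) :
    (F ^ n) x = (F : CircleDeg1Lift)^[n] x := by
  rw [Units.val_pow_eq_pow_val, CircleDeg1Lift.coe_pow]

lemma contract_right (F : CircleDeg1Liftˣ) {u w : ℝ} (huw : u < w) (hu : F u = u)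
    (hfix : ∀ x ∈ Ioc u w, F x ≠ x) (hw : F w < w) {ε : ℝ} (hε : 0 < ε) :
    ∃ n : ℕ, (F ^ n) w < u + ε := by
  have hanti : Antitone (fun n : ℕ => (F : CircleDeg1Lift)^[n] w) := by
    apply antitone_nat_of_succ_le
    intro n
    rw [Function.iterate_succ_apply]
    exact ((cu_strictMono F).monotone.iterate n) hw.le
  have hlow : ∀ n : ℕ, u ≤ (F : CircleDeg1Lift)^[n] w := by
    intro n
    have h1 := ((cu_strictMono F).monotone.iterate n) huw.le
    rwa [Function.iterate_fixed hu] at h1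
  have ht := tendsto_atTop_ciInf hanti ⟨u, by rintro _ ⟨n, rfl⟩; exact hlow n⟩
  set z := ⨅ n : ℕ, (F : CircleDeg1Lift)^[n] w
  have hz : F z = z := isFixedPt_of_tendsto_iterate ht (cu_continuous F).continuousAt
  have hzu : u ≤ z := ge_of_tendsto' ht hlow
  have hzw : z ≤ w := le_of_tendsto' ht (fun n => by simpa using hanti (Nat.zero_le n))
  have hzz : z = u := by
    by_contra hne
    exact hfix z ⟨lt_of_le_of_ne hzu (Ne.symm hne), hzw⟩ hz
  rw [hzz] at ht
  obtain ⟨n, hn⟩ := (ht.eventually (gt_mem_nhds (show u < u + ε by linarith))).exists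
  exact ⟨n, by rw [cu_pow_apply]; exact hn⟩

lemma contract_left (F : CircleDeg1Liftˣ) {u w : ℝ} (huw : u < w) (hw : F w = w)
    (hfix : ∀ x ∈ Ico u w, F x ≠ x) (hu : u < F u) {ε : ℝ} (hε : 0 < ε) :
    ∃ n : ℕ, w - ε < (F ^ n) u := by
  have hmono : Monotone (fun n : ℕ => (F : CircleDeg1Lift)^[n] u) := by
    apply monotone_nat_of_le_succ
    intro n
    rw [Function.iterate_succ_apply]
    exact ((cu_strictMono F).monotone.iterate n) hu.le
  have hup : ∀ n : ℕ, (F : CircleDeg1Lift)^[n] u ≤ w := by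
    intro n
    have h1 := ((cu_strictMono F).monotone.iterate n) huw.le
    rwa [Function.iterate_fixed hw] at h1
  have ht := tendsto_atTop_ciSup hmono ⟨w, by rintro _ ⟨n, rfl⟩; exact hup n⟩
  set z := ⨆ n : ℕ, (F : CircleDeg1Lift)^[n] u
  have hz : F z = z := isFixedPt_of_tendsto_iterate ht (cu_continuous F).continuousAt
  have hzw : z ≤ w := le_of_tendsto' ht hup
  have hzu : u ≤ z := ge_of_tendsto' ht (fun n => by simpa using hmono (Nat.zero_le n))
  have hzz : z = w := by
    by_contra hne
    exact hfix z ⟨hzu, lt_of_le_of_ne hzw hne⟩ hz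
  rw [hzz] at ht
  obtain ⟨n, hn⟩ := (ht.eventually (lt_mem_nhds (show w - ε < w by linarith))).exists
  exact ⟨n, by rw [cu_pow_apply]; exact hn⟩

lemma cu_inv_fix {F : CircleDeg1Liftˣ} {x : ℝ} : F⁻¹ x = x ↔ F x = x := by
  constructor <;> intro h
  · have := congrArg (fun t => F t) h
    simp only [CircleDeg1Lift.units_apply_inv_apply] at this
    exact this.symm
  · have := congrArg (fun t => F⁻¹ t) h
    simp only [CircleDeg1Lift.units_inv_apply_apply] at this
    exact this.symm

lemma exists_pingpong {G : Subgroup CircleDeg1Liftˣ} (hG : ¬ CommonFix G) :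
    ∃ u w : ℝ, u < w ∧ ∃ F ∈ G, ∃ H ∈ G, F u = u ∧ H w = w ∧ F w < H u := by
  unfold CommonFix at hG
  push Not at hG
  obtain ⟨f, hf, g, hg, ⟨u0, hu0⟩, ⟨y, hy⟩, hno⟩ := hG
  -- first fixed point of `g` to the right of `u0`
  have hAc : IsClosed ({x | g x = x} ∩ Ici u0) :=
    (isClosed_eq (cu_continuous g) continuous_id).inter isClosed_Ici
  have hAn : ({x | g x = x} ∩ Ici u0).Nonempty := by
    obtain ⟨n, hn⟩ := exists_nat_gt (u0 - y)
    refine ⟨y + n, ?_, ?_⟩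
    · simp only [mem_ofPred_eq]
      rw [CircleDeg1Lift.map_add_nat, hy]
    · simp only [mem_Ici]; linarith
  have hAb : BddBelow ({x | g x = x} ∩ Ici u0) := ⟨u0, fun x hx => hx.2⟩
  have hw := hAc.csInf_mem hAn hAb
  set w := sInf ({x | g x = x} ∩ Ici u0) with hwdef
  have hBc : IsClosed ({x | f x = x} ∩ Icc u0 w) :=
    (isClosed_eq (cu_continuous f) continuous_id).inter isClosed_Icc
  have hBn : ({x | f x = x} ∩ Icc u0 w).Nonempty := ⟨u0, hu0, le_rfl, hw.2⟩
  have hBb : BddAbove ({x | f x = x} ∩ Icc u0 w) := ⟨w, fun x hx => hx.2.2⟩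
  have hu := hBc.csSup_mem hBn hBb
  set u := sSup ({x | f x = x} ∩ Icc u0 w) with hudef
  have hfu : f u = u := hu.1
  have hgw : g w = w := hw.1
  have huw : u < w := by
    apply lt_of_le_of_ne hu.2.2
    intro h
    exact hno u hfu (by rw [h]; exact hgw)
  have hf' : ∀ x ∈ Ioc u w, f x ≠ x := by
    intro x hx hfx
    exact absurd (le_csSup hBb ⟨hfx, hu.2.1.trans hx.1.le, hx.2⟩) (not_le.2 hx.1)
  have hg' : ∀ x ∈ Ico u w, g x ≠ x := by
    intro x hx hgx
    exact absurd (csInf_le hAb ⟨hgx, hu.2.1.trans hx.1⟩) (not_le.2 hx.2)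
  have hε : 0 < (w - u) / 2 := by linarith
  -- contracting element fixing `u`
  have h1 : ∃ F ∈ G, F u = u ∧ F w < u + (w - u) / 2 := by
    rcases lt_or_gt_of_ne (hf' w ⟨huw, le_rfl⟩) with h | h
    · obtain ⟨n, hn⟩ := contract_right f huw hfu hf' h hε
      exact ⟨f ^ n, pow_mem hf n, by rw [cu_pow_apply, Function.iterate_fixed hfu], hn⟩
    · have h' : f⁻¹ w < w := by
        have := cu_strictMono f⁻¹ h
        rwa [CircleDeg1Lift.units_inv_apply_apply] at this
      have hfu' : f⁻¹ u = u := cu_inv_fix.2 hfu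
      obtain ⟨n, hn⟩ := contract_right f⁻¹ huw hfu'
        (fun x hx hh => hf' x hx (cu_inv_fix.1 hh)) h' hε
      exact ⟨f⁻¹ ^ n, pow_mem (inv_mem hf) n,
        by rw [cu_pow_apply, Function.iterate_fixed hfu'], hn⟩
  have h2 : ∃ H ∈ G, H w = w ∧ w - (w - u) / 2 < H u := by
    rcases lt_or_gt_of_ne (hg' u ⟨le_rfl, huw⟩) with h | h
    · have h' : u < g⁻¹ u := by
        have := cu_strictMono g⁻¹ h
        rwa [CircleDeg1Lift.units_inv_apply_apply] at this
      have hgw' : g⁻¹ w = w := cu_inv_fix.2 hgw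
      obtain ⟨n, hn⟩ := contract_left g⁻¹ huw hgw'
        (fun x hx hh => hg' x hx (cu_inv_fix.1 hh)) h' hε
      exact ⟨g⁻¹ ^ n, pow_mem (inv_mem hg) n,
        by rw [cu_pow_apply, Function.iterate_fixed hgw'], hn⟩
    · obtain ⟨n, hn⟩ := contract_left g huw hgw hg' h hε
      exact ⟨g ^ n, pow_mem hg n, by rw [cu_pow_apply, Function.iterate_fixed hgw], hn⟩
  obtain ⟨F, hF, hFu, hFw⟩ := h1
  obtain ⟨H, hH, hHw, hHu⟩ := h2
  exact ⟨u, w, huw, F, hF, H, hH, hFu, hHw, by linarith⟩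

/-- Sum of a function over all words of length `n`. -/
def wsum : ℕ → (List Bool → ℝ) → ℝ
  | 0, φ => φ []
  | n + 1, φ => wsum n (fun l => φ (true :: l) + φ (false :: l))

lemma wsum_mono (n : ℕ) (φ ψ : List Bool → ℝ) (h : ∀ l, l.length = n → φ l ≤ ψ l) :
    wsum n φ ≤ wsum n ψ := by
  induction n generalizing φ ψ with
  | zero => exact h [] rfl
  | succ n ih =>
    apply ih
    intro l hl
    exact add_le_add (h _ (by simp [hl])) (h _ (by simp [hl]))

lemma wsum_lin (n : ℕ) (φ ψ : List Bool → ℝ) (a b : ℝ) :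
    wsum n (fun l => a * φ l + b * ψ l) = a * wsum n φ + b * wsum n ψ := by
  induction n generalizing φ ψ with
  | zero => rfl
  | succ n ih =>
    simp only [wsum]
    rw [← ih]
    congr 1; ext l; ring

lemma wsum_const (n : ℕ) (c : ℝ) : wsum n (fun _ => c) = 2 ^ n * c := by
  induction n generalizing c with
  | zero => simp [wsum]
  | succ n ih => simp only [wsum]; rw [ih]; ring

lemma wsum_snoc (n : ℕ) (φ : List Bool → ℝ) :
    wsum (n + 1) φ = wsum n (fun l => φ (l ++ [true]) + φ (l ++ [false])) := by
  induction n generalizing φ with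
  | zero => rfl
  | succ n ih =>
    rw [wsum, ih, wsum]
    congr 1; ext l
    simp only [List.cons_append]
    ring

section words
variable (c : Bool → CircleDeg1Liftˣ)

def word : List Bool → CircleDeg1Liftˣ
  | [] => 1
  | b :: l => c b * word l

lemma word_snoc (l : List Bool) (b : Bool) : word c (l ++ [b]) = word c l * c b := by
  induction l with
  | nil => simp [word]
  | cons a l ih => simp [word, ih, mul_assoc]

variable (u w : ℝ)

def wlen (l : List Bool) : ℝ := word c l w - word c l u

def wQ : List Bool → ℝ
  | [] => w - u
  | b :: l => wQ l + (3 / 2) ^ (l.length + 1) * wlen c u w (b :: l)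

def wR : List Bool → ℝ
  | [] => 0
  | _ :: l => wR l + wlen c u w l

variable {u w}

lemma wlen_pos (huw : u < w) (l : List Bool) : 0 < wlen c u w l := by
  unfold wlen
  have := cu_strictMono (word c l) huw
  linarith

lemma wQ_ge (huw : u < w) (l : List Bool) : (3 / 2) ^ l.length * wlen c u w l ≤ wQ c u w l ∧
    wR c u w l + wlen c u w l ≤ wQ c u w l := by
  induction l with
  | nil => simp [wlen, word, wQ, wR]
  | cons b l ih =>
    have hp := wlen_pos c huw l
    have hp' := wlen_pos c huw (b :: l)
    have hpow : (1 : ℝ) ≤ (3 / 2) ^ (l.length + 1) := one_le_pow₀ (by norm_num)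
    have : 0 < (3 / 2 : ℝ) ^ l.length := by positivity
    simp only [wQ, wR, List.length_cons]
    constructor
    · nlinarith [ih.1]
    · nlinarith [ih.2]


lemma wsum_wlen (huw : u < w) (h0 : u ≤ c true u) (h1 : c true w < c false u) (h2 : c false w ≤ w) (n : ℕ) : wsum n (wlen c u w) ≤ w - u := by
  induction n with
  | zero => simp [wsum, wlen, word]
  | succ n ih =>
    rw [wsum_snoc]
    refine le_trans (wsum_mono n _ _ ?_) ih
    intro l _
    unfold wlen
    rw [word_snoc, word_snoc]
    simp only [cu_mul]
    have a1 := (cu_strictMono (word c l)).monotone h0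
    have a2 := (cu_strictMono (word c l)) h1
    have a3 := (cu_strictMono (word c l)).monotone h2
    linarith

lemma wsum_wQ (huw : u < w) (h0 : u ≤ c true u) (h1 : c true w < c false u) (h2 : c false w ≤ w) (n : ℕ) : wsum n (wQ c u w) ≤ 2 ^ n * ((w - u) * (4 - 3 * (3 / 4) ^ n)) := by
  induction n with
  | zero => simp only [wsum, wQ]; apply le_of_eq; norm_num
  | succ n ih =>
    have e : wsum (n + 1) (wQ c u w)
        ≤ 2 * wsum n (wQ c u w) + (3 / 2) ^ (n + 1) * wsum (n + 1) (wlen c u w) := by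
      simp only [wsum]
      rw [← wsum_lin]
      apply wsum_mono
      intro l hl
      simp only [wQ, hl]
      apply le_of_eq; ring
    have h3 := wsum_wlen c huw h0 h1 h2 (n + 1)
    have h4 : (3 / 2 : ℝ) ^ (n + 1) * wsum (n + 1) (wlen c u w) ≤ (3 / 2) ^ (n + 1) * (w - u) :=
      mul_le_mul_of_nonneg_left h3 (by positivity)
    have h5 : (3 / 2 : ℝ) ^ (n + 1) = 2 ^ (n + 1) * (3 / 4) ^ (n + 1) := by
      rw [← mul_pow]; norm_num
    rw [h5] at e h4
    refine e.trans ?_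
    have h6 : (2 : ℝ) * wsum n (wQ c u w) ≤ 2 * (2 ^ n * ((w - u) * (4 - 3 * (3 / 4) ^ n))) := by
      linarith
    refine (add_le_add h6 h4).trans (le_of_eq ?_)
    ring

lemma exists_good_word (huw : u < w) (h0 : u ≤ c true u) (h1 : c true w < c false u) (h2 : c false w ≤ w) (n : ℕ) : ∃ l : List Bool, l.length = n ∧ wQ c u w l ≤ 4 * (w - u) := by
  by_contra hcon
  push Not at hcon
  have h3 := wsum_mono n (fun _ => 4 * (w - u)) (wQ c u w) (fun l hl => (hcon l hl).le)
  rw [wsum_const] at h3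
  have h4 := h3.trans (wsum_wQ c huw h0 h1 h2 n)
  have h5 : (0 : ℝ) < 2 ^ n := by positivity
  have h6 : (0 : ℝ) < (3 / 4) ^ n := by positivity
  have h7 := le_of_mul_le_mul_left h4 h5
  nlinarith

lemma word_maps (huw : u < w) (h0 : u ≤ c true u) (h1 : c true w < c false u) (h2 : c false w ≤ w) (l : List Bool) : ∀ x ∈ Icc u w, word c l x ∈ Icc u w := by
  induction l with
  | nil => intro x hx; exact hx
  | cons b l ih =>
    intro x hx
    have := ih x hx
    simp only [word, cu_mul]
    have m1 := (cu_strictMono (c b)).monotone this.1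
    have m2 := (cu_strictMono (c b)).monotone this.2
    have m3 := cu_strictMono (c true) huw
    have m4 := cu_strictMono (c false) huw
    cases b
    · exact ⟨by linarith, by linarith⟩
    · exact ⟨by linarith, by linarith⟩

lemma word_distortion (huw : u < w) (h0 : u ≤ c true u) (h1 : c true w < c false u) (h2 : c false w ≤ w) (hd : ∀ b, Differentiable ℝ (c b : CircleDeg1Lift))
    (hpos : ∀ b x, 0 < deriv (c b : CircleDeg1Lift) x) {K : ℝ} (hK0 : 0 ≤ K)
    (hK : ∀ b, ∀ x ∈ Icc u w, ∀ y ∈ Icc u w, deriv (c b : CircleDeg1Lift) x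
      ≤ Real.exp (K * |x - y|) * deriv (c b : CircleDeg1Lift) y) (l : List Bool) :
    Differentiable ℝ (word c l : CircleDeg1Lift) ∧
    (∀ x, 0 < deriv (word c l : CircleDeg1Lift) x) ∧
    ∀ x ∈ Icc u w, ∀ y ∈ Icc u w, deriv (word c l : CircleDeg1Lift) x
      ≤ Real.exp (K * wR c u w l) * deriv (word c l : CircleDeg1Lift) y := by
  induction l with
  | nil =>
    have : ((word c [] : CircleDeg1Liftˣ) : CircleDeg1Lift) = (id : ℝ → ℝ) := rfl
    rw [this]
    refine ⟨differentiable_id, ?_, ?_⟩ <;> intros <;> simp [wR]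
  | cons b l ih =>
    obtain ⟨i1, i2, i3⟩ := ih
    have e : ((word c (b :: l) : CircleDeg1Liftˣ) : CircleDeg1Lift)
      = ((c b : CircleDeg1Lift) : ℝ → ℝ) ∘ ((word c l : CircleDeg1Lift) : ℝ → ℝ) := rfl
    have ed : ∀ x, deriv (word c (b :: l) : CircleDeg1Lift) x
        = deriv (c b : CircleDeg1Lift) (word c l x) * deriv (word c l : CircleDeg1Lift) x := by
      intro x
      rw [e]
      exact deriv_comp x (hd b _) (i1 x)
    refine ⟨by rw [e]; exact (hd b).comp i1, ?_, ?_⟩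
    · intro x; rw [ed]; exact mul_pos (hpos _ _) (i2 x)
    · intro x hx y hy
      rw [ed, ed]
      have wx := word_maps c huw h0 h1 h2 l x hx
      have wy := word_maps c huw h0 h1 h2 l y hy
      have b1 := hK b _ wx _ wy
      have b2 := i3 x hx y hy
      have b3 : |word c l x - word c l y| ≤ wlen c u w l := by
        have m1 := (cu_strictMono (word c l)).monotone hx.1
        have m2 := (cu_strictMono (word c l)).monotone hx.2
        have m3 := (cu_strictMono (word c l)).monotone hy.1
        have m4 := (cu_strictMono (word c l)).monotone hy.2
        unfold wlen
        rw [abs_le]; constructor <;> linarith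
      have b4 : Real.exp (K * |word c l x - word c l y|) ≤ Real.exp (K * wlen c u w l) :=
        Real.exp_le_exp.2 (mul_le_mul_of_nonneg_left b3 hK0)
      have b5 : deriv (c b : CircleDeg1Lift) (word c l x)
          ≤ Real.exp (K * wlen c u w l) * deriv (c b : CircleDeg1Lift) (word c l y) :=
        b1.trans (mul_le_mul_of_nonneg_right b4 (hpos _ _).le)
      calc _ ≤ (Real.exp (K * wlen c u w l) * deriv (c b : CircleDeg1Lift) (word c l y)) *
            (Real.exp (K * wR c u w l) * deriv (word c l : CircleDeg1Lift) y) :=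
            mul_le_mul b5 b2 (i2 x).le (mul_pos (Real.exp_pos _) (hpos _ _)).le
        _ = _ := by
            simp only [wR]
            rw [mul_add, Real.exp_add]; ring

lemma exists_contracting_word (huw : u < w) (h0 : u ≤ c true u) (h1 : c true w < c false u) (h2 : c false w ≤ w) (hd : ∀ b, Differentiable ℝ (c b : CircleDeg1Lift))
    (hpos : ∀ b x, 0 < deriv (c b : CircleDeg1Lift) x) {K : ℝ} (hK0 : 0 ≤ K)
    (hK : ∀ b, ∀ x ∈ Icc u w, ∀ y ∈ Icc u w, deriv (c b : CircleDeg1Lift) x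
      ≤ Real.exp (K * |x - y|) * deriv (c b : CircleDeg1Lift) y) :
    ∃ l : List Bool, ∃ p, word c l p = p ∧ deriv (word c l : CircleDeg1Lift) p < 1 := by
  set C := Real.exp (K * (4 * (w - u))) * 4 with hC
  have hCpos : 0 < C := by positivity
  obtain ⟨n, hn⟩ := exists_pow_lt_of_lt_one (inv_pos.2 hCpos) (show (2 / 3 : ℝ) < 1 by norm_num)
  obtain ⟨l, hl, hQ⟩ := exists_good_word c huw h0 h1 h2 n
  obtain ⟨d1, d2, d3⟩ := word_distortion c huw h0 h1 h2 hd hpos hK0 hK l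
  obtain ⟨p, hp, hpf⟩ : ∃ p ∈ Icc u w, word c l p = p := by
    have hmu := word_maps c huw h0 h1 h2 l u ⟨le_rfl, huw.le⟩
    have hmw := word_maps c huw h0 h1 h2 l w ⟨huw.le, le_rfl⟩
    have hcont : ContinuousOn (fun t => word c l t - t) (Icc u w) :=
      ((cu_continuous (word c l)).sub continuous_id).continuousOn
    have := intermediate_value_Icc' huw.le hcont (show (0 : ℝ) ∈ _ from
      ⟨by linarith [hmw.2], by linarith [hmu.1]⟩)
    obtain ⟨p, hp, hpp⟩ := this
    exact ⟨p, hp, by simpa [sub_eq_zero] using hpp⟩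
  refine ⟨l, p, hpf, ?_⟩
  obtain ⟨ξ, hξ, hξd⟩ := exists_deriv_eq_slope (word c l : CircleDeg1Lift) huw
    d1.continuous.continuousOn d1.differentiableOn
  have q := wQ_ge c huw l
  have hlp := wlen_pos c huw l
  have hlen : wlen c u w l ≤ (2 / 3) ^ n * (4 * (w - u)) := by
    have h3 := q.1.trans hQ
    rw [hl] at h3
    have h4 : (2 / 3 : ℝ) ^ n * (3 / 2) ^ n = 1 := by rw [← mul_pow]; norm_num
    calc wlen c u w l = (2 / 3) ^ n * ((3 / 2) ^ n * wlen c u w l) := by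
          rw [← mul_assoc, h4, one_mul]
      _ ≤ _ := mul_le_mul_of_nonneg_left h3 (by positivity)
  have hR : wR c u w l ≤ 4 * (w - u) := by linarith [q.2]
  have h5 := d3 p hp ξ ⟨hξ.1.le, hξ.2.le⟩
  have h6 : deriv (word c l : CircleDeg1Lift) ξ ≤ (2 / 3) ^ n * 4 := by
    rw [hξd, div_le_iff₀ (by linarith)]
    unfold wlen at hlen
    linarith
  calc deriv (word c l : CircleDeg1Lift) p
      ≤ Real.exp (K * wR c u w l) * deriv (word c l : CircleDeg1Lift) ξ := h5
    _ ≤ Real.exp (K * (4 * (w - u))) * ((2 / 3) ^ n * 4) := by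
        apply mul_le_mul _ h6 (d2 _).le (Real.exp_pos _).le
        exact Real.exp_le_exp.2 (mul_le_mul_of_nonneg_left hR hK0)
    _ = C * (2 / 3) ^ n := by rw [hC]; ring
    _ < C * C⁻¹ := mul_lt_mul_of_pos_left hn hCpos
    _ = 1 := mul_inv_cancel₀ hCpos.ne'

end words

def GoodGroup (G : Subgroup CircleDeg1Liftˣ) : Prop :=
  ∀ F ∈ G, AnalyticOnNhd ℝ (F : CircleDeg1Lift) univ ∧ ∀ x, 0 < deriv (F : CircleDeg1Lift) x

lemma logderiv_lip' {f : ℝ → ℝ} (hf : AnalyticOnNhd ℝ f univ) (hpos : ∀ x, 0 < deriv f x)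
    (u w : ℝ) : ∃ K, 0 ≤ K ∧ ∀ x ∈ Icc u w, ∀ y ∈ Icc u w,
      |Real.log (deriv f x) - Real.log (deriv f y)| ≤ K * |x - y| := by
  have h1 : AnalyticOnNhd ℝ (deriv f) univ := hf.deriv
  have hcd : ContDiff ℝ 1 (fun x => Real.log (deriv f x)) := by
    apply ContDiff.log
    · exact (contDiffOn_univ.1 (h1.contDiffOn uniqueDiffOn_univ))
    · exact fun x => (hpos x).ne'
  have hc := (hcd.continuous_deriv le_rfl).norm
  obtain ⟨C, hC⟩ := (isCompact_Icc (a := u) (b := w)).exists_bound_of_continuousOn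
    hc.continuousOn
  refine ⟨max C 0, le_max_right _ _, ?_⟩
  intro x hx y hy
  have := Convex.norm_image_sub_le_of_norm_deriv_le (f := fun x => Real.log (deriv f x))
    (C := max C 0) (s := Icc u w)
    (fun z _ => (hcd.differentiable one_ne_zero) z)
    (fun z hz => by have := hC z hz; rw [norm_norm] at this; exact this.trans (le_max_left _ _))
    (convex_Icc u w) hy hx
  rwa [Real.norm_eq_abs, Real.norm_eq_abs] at this

lemma logderiv_lip {f : ℝ → ℝ} (hf : AnalyticOnNhd ℝ f univ) (hpos : ∀ x, 0 < deriv f x)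
    (u w : ℝ) : ∃ K, 0 ≤ K ∧ ∀ x ∈ Icc u w, ∀ y ∈ Icc u w,
      deriv f x ≤ Real.exp (K * |x - y|) * deriv f y := by
  obtain ⟨K, hK, h⟩ := logderiv_lip' hf hpos u w
  refine ⟨K, hK, fun x hx y hy => ?_⟩
  have h2 := (abs_le.1 (h x hx y hy)).2
  rw [← Real.exp_log (hpos x)]
  conv_rhs => rw [← Real.exp_log (hpos y)]
  rw [← Real.exp_add, Real.exp_le_exp]
  linarith

lemma exists_hyperbolic {G : Subgroup CircleDeg1Liftˣ} (hG : ¬ CommonFix G) (hgood : GoodGroup G) :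
    ∃ h ∈ G, ∃ p, h p = p ∧ deriv (h : CircleDeg1Lift) p < 1 := by
  obtain ⟨u, w, huw, F, hF, H, hH, hFu, hHw, hFH⟩ := exists_pingpong hG
  let c : Bool → CircleDeg1Liftˣ := fun b => if b then F else H
  have hc : ∀ b, c b ∈ G := by intro b; cases b <;> simp [c, hF, hH]
  obtain ⟨K1, hK1, hK1'⟩ := logderiv_lip (hgood _ (hc true)).1 (hgood _ (hc true)).2 u w
  obtain ⟨K2, hK2, hK2'⟩ := logderiv_lip (hgood _ (hc false)).1 (hgood _ (hc false)).2 u w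
  have hw : ∀ l, word c l ∈ G := by
    intro l
    induction l with
    | nil => exact one_mem G
    | cons b l ih => exact mul_mem (hc b) ih
  obtain ⟨l, p, hp, hd⟩ := exists_contracting_word c huw (by simp [c, hFu]) (by simpa [c] using hFH)
    (by simp [c, hHw]) (fun b x => ((hgood _ (hc b)).1 x (mem_univ x)).differentiableAt)
    (fun b => (hgood _ (hc b)).2) (K := max K1 K2) (hK1.trans (le_max_left _ _)) (by
      intro b x hx y hy
      cases b
      · refine (hK2' x hx y hy).trans (mul_le_mul_of_nonneg_right (Real.exp_le_exp.2 ?_)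
          ((hgood _ (hc false)).2 y).le)
        exact mul_le_mul_of_nonneg_right (le_max_right _ _) (abs_nonneg _)
      · refine (hK1' x hx y hy).trans (mul_le_mul_of_nonneg_right (Real.exp_le_exp.2 ?_)
          ((hgood _ (hc true)).2 y).le)
        exact mul_le_mul_of_nonneg_right (le_max_left _ _) (abs_nonneg _))
  exact ⟨word c l, hw l, p, hp, hd⟩
/-! ### Part C: Koenigs linearization -/

lemma mvt_lower {T τ : ℝ → ℝ} {a b κ : ℝ} (hd : ∀ x ∈ Ioo a b, HasDerivAt T (τ x) x)
    (hτ : ∀ x ∈ Ioo a b, κ ≤ τ x) {x y : ℝ} (hx : x ∈ Ioo a b) (hy : y ∈ Ioo a b) (hxy : x ≤ y) :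
    κ * (y - x) ≤ T y - T x := by
  rcases eq_or_lt_of_le hxy with rfl | hlt
  · simp
  · have hs : ∀ z ∈ Icc x y, z ∈ Ioo a b := fun z hz => ⟨hx.1.trans_le hz.1, hz.2.trans_lt hy.2⟩
    obtain ⟨ξ, hξ, he⟩ := exists_hasDerivAt_eq_slope T τ hlt
      (fun z hz => (hd z (hs z hz)).continuousAt.continuousWithinAt)
      (fun z hz => hd z (hs z ⟨hz.1.le, hz.2.le⟩))
    have := hτ ξ (hs ξ ⟨hξ.1.le, hξ.2.le⟩)
    rw [he, le_div_iff₀ (by linarith)] at this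
    exact this

lemma mvt_upper {T τ : ℝ → ℝ} {a b κ : ℝ} (hd : ∀ x ∈ Ioo a b, HasDerivAt T (τ x) x)
    (hτ : ∀ x ∈ Ioo a b, τ x ≤ κ) {x y : ℝ} (hx : x ∈ Ioo a b) (hy : y ∈ Ioo a b) (hxy : x ≤ y) :
    T y - T x ≤ κ * (y - x) := by
  rcases eq_or_lt_of_le hxy with rfl | hlt
  · simp
  · have hs : ∀ z ∈ Icc x y, z ∈ Ioo a b := fun z hz => ⟨hx.1.trans_le hz.1, hz.2.trans_lt hy.2⟩
    obtain ⟨ξ, hξ, he⟩ := exists_hasDerivAt_eq_slope T τ hlt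
      (fun z hz => (hd z (hs z hz)).continuousAt.continuousWithinAt)
      (fun z hz => hd z (hs z ⟨hz.1.le, hz.2.le⟩))
    have := hτ ξ (hs ξ ⟨hξ.1.le, hξ.2.le⟩)
    rw [he, div_le_iff₀ (by linarith)] at this
    exact this

structure Koenigs (h : ℝ → ℝ) (p lam r : ℝ) (φ ψ : ℝ → ℝ) : Prop where
  r_pos : 0 < r
  r_le : r ≤ 1
  lam_pos : 0 < lam
  lam_lt : lam < 1
  maps : ∀ x ∈ Ioo (p - r) (p + r), h x ∈ Ioo (p - r) (p + r)
  deriv_phi : ∀ x ∈ Ioo (p - r) (p + r), HasDerivAt φ (ψ x) x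
  psi_ge : ∀ x ∈ Ioo (p - r) (p + r), 1 / 2 ≤ ψ x
  psi_le : ∀ x ∈ Ioo (p - r) (p + r), ψ x ≤ 2
  conj : ∀ x ∈ Ioo (p - r) (p + r), φ (h x) = lam * φ x
  psi_cont : ContinuousOn ψ (Ioo (p - r) (p + r))
  psi_p : ψ p = 1
  phi_p : φ p = 0

lemma exists_koenigs {h : ℝ → ℝ} (hA : AnalyticOnNhd ℝ h univ) (hpos : ∀ x, 0 < deriv h x)
    {p : ℝ} (hp : h p = p) (hlt : deriv h p < 1) :
    ∃ r φ ψ, Koenigs h p (deriv h p) r φ ψ := by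
  have hdiff : ∀ x, DifferentiableAt ℝ h x := fun x => (hA x (mem_univ x)).differentiableAt
  have hdc : Continuous (deriv h) := by
    rw [← continuousOn_univ]; exact hA.deriv.continuousOn
  obtain ⟨ρ, hρ1, hρ2⟩ := exists_between hlt
  have hρ0 : 0 < ρ := (hpos p).trans hρ1
  obtain ⟨K, hK0, hK⟩ := logderiv_lip' hA hpos (p - 1) (p + 1)
  obtain ⟨r1, hr1, hr1'⟩ : ∃ r1 > 0, ∀ x ∈ Ioo (p - r1) (p + r1), deriv h x ≤ ρ := by
    have := (hdc.tendsto p).eventually (gt_mem_nhds hρ1)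
    obtain ⟨e, he, hb⟩ := Metric.eventually_nhds_iff_ball.1 this
    refine ⟨e, he, fun x hx => (hb x ?_).le⟩
    rw [Real.ball_eq_Ioo]; exact hx
  have hlog2 : 0 < Real.log 2 := Real.log_pos one_lt_two
  set q := Real.log 2 * (1 - ρ) / (K + 1) with hq
  have hqpos : 0 < q := by
    apply div_pos (mul_pos hlog2 (by linarith)) (by linarith)
  set r := min r1 (min 1 q) with hr
  have hr0 : 0 < r := lt_min hr1 (lt_min one_pos hqpos)
  have hrr1 : r ≤ r1 := min_le_left _ _
  have hr1' : ∀ x ∈ Ioo (p - r) (p + r), deriv h x ≤ ρ := fun x hx =>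
    hr1' x ⟨by linarith [hx.1], by linarith [hx.2]⟩
  have hrle : r ≤ 1 := (min_le_right _ _).trans (min_le_left _ _)
  have hrq : r ≤ q := (min_le_right _ _).trans (min_le_right _ _)
  have hpU : p ∈ Ioo (p - r) (p + r) := ⟨by linarith, by linarith⟩
  have habs : ∀ x, x ∈ Ioo (p - r) (p + r) ↔ |x - p| < r := by
    intro x; rw [abs_lt]; constructor
    · rintro ⟨a, b⟩; constructor <;> linarith
    · rintro ⟨a, b⟩; constructor <;> linarith
  have hcontr : ∀ x ∈ Ioo (p - r) (p + r), |h x - p| ≤ ρ * |x - p| := by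
    intro x hx
    have hd : ∀ x ∈ Ioo (p - r) (p + r), HasDerivAt h (deriv h x) x := fun x _ =>
      (hdiff x).hasDerivAt
    rcases le_total p x with hle | hle
    · have h1 := mvt_upper hd hr1' hpU hx hle
      have h2 := mvt_lower hd (fun z _ => (hpos z).le) hpU hx hle
      rw [hp] at h1 h2
      rw [abs_of_nonneg (by linarith), abs_of_nonneg (by linarith)]
      linarith
    · have h1 := mvt_upper hd hr1' hx hpU hle
      have h2 := mvt_lower hd (fun z _ => (hpos z).le) hx hpU hle
      rw [hp] at h1 h2
      rw [abs_of_nonpos (by linarith), abs_of_nonpos (by linarith)]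
      linarith
  have hmaps : ∀ x ∈ Ioo (p - r) (p + r), h x ∈ Ioo (p - r) (p + r) := by
    intro x hx
    rw [habs] at *
    have := hcontr x ((habs x).2 hx)
    nlinarith [abs_nonneg (x - p)]
  have hiter : ∀ k : ℕ, ∀ x ∈ Ioo (p - r) (p + r), h^[k] x ∈ Ioo (p - r) (p + r) ∧
      |h^[k] x - p| ≤ ρ ^ k * |x - p| := by
    intro k
    induction k with
    | zero => intro x hx; exact ⟨hx, by simp⟩
    | succ k ih =>
      intro x hx
      obtain ⟨i1, i2⟩ := ih x hx
      rw [Function.iterate_succ_apply']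
      refine ⟨hmaps _ i1, (hcontr _ i1).trans ?_⟩
      rw [pow_succ']
      nlinarith
  set L : ℝ → ℝ := fun x => Real.log (deriv h x) - Real.log (deriv h p) with hL
  have hLc : Continuous L := (hdc.log (fun x => (hpos x).ne')).sub continuous_const
  have hLb : ∀ k : ℕ, ∀ x ∈ Ioo (p - r) (p + r), ‖L (h^[k] x)‖ ≤ K * r * ρ ^ k := by
    intro k x hx
    obtain ⟨i1, i2⟩ := hiter k x hx
    have h3 := hK (h^[k] x) ⟨by linarith [i1.1], by linarith [i1.2]⟩ p
      ⟨by linarith, by linarith⟩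
    rw [Real.norm_eq_abs]
    refine h3.trans ?_
    have h4 : |h^[k] x - p| ≤ ρ ^ k * r :=
      i2.trans (mul_le_mul_of_nonneg_left ((habs x).1 hx).le (by positivity))
    calc K * |h^[k] x - p| ≤ K * (ρ ^ k * r) := mul_le_mul_of_nonneg_left h4 hK0
      _ = _ := by ring
  have hsum : Summable (fun k : ℕ => K * r * ρ ^ k) :=
    (summable_geometric_of_lt_one hρ0.le hρ2).mul_left _
  set S : ℝ → ℝ := fun x => ∑' k : ℕ, L (h^[k] x) with hS
  have hSc : ContinuousOn S (Ioo (p - r) (p + r)) := by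
    apply continuousOn_tsum (u := fun k : ℕ => K * r * ρ ^ k) _ hsum hLb
    intro k
    exact (hLc.comp ((continuous_iff_continuousAt.2 fun x => (hdiff x).continuousAt).iterate k)).continuousOn
  have hsummable : ∀ x ∈ Ioo (p - r) (p + r), Summable (fun k : ℕ => L (h^[k] x)) := fun x hx =>
    Summable.of_norm_bounded hsum (fun k => hLb k x hx)
  have hSb : ∀ x ∈ Ioo (p - r) (p + r), |S x| ≤ Real.log 2 := by
    intro x hx
    have h1 := tsum_of_norm_bounded (hsum.hasSum) (fun k => hLb k x hx)
    rw [tsum_mul_left, tsum_geometric_of_lt_one hρ0.le hρ2] at h1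
    rw [← Real.norm_eq_abs]
    refine h1.trans ?_
    rw [← div_eq_mul_inv, div_le_iff₀ (by linarith)]
    have h2 : r * (K + 1) ≤ Real.log 2 * (1 - ρ) := by
      rw [hq, le_div_iff₀ (by linarith)] at hrq
      exact hrq
    nlinarith
  have hSrec : ∀ x ∈ Ioo (p - r) (p + r), S x = L x + S (h x) := by
    intro x hx
    have := (hsummable x hx).tsum_eq_zero_add
    simp only [hS]
    rw [this]
    simp [Function.iterate_succ_apply]
  have hSp : S p = 0 := by
    simp only [hS]
    rw [← tsum_zero (α := ℝ) (β := ℕ)]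
    congr 1; ext k
    rw [Function.iterate_fixed hp]; simp [hL]
  set ψ : ℝ → ℝ := fun x => Real.exp (S x) with hψ
  have hψc : ContinuousOn ψ (Ioo (p - r) (p + r)) := Real.continuous_exp.comp_continuousOn hSc
  set φ : ℝ → ℝ := fun x => ∫ t in p..x, ψ t with hφ
  have hφd : ∀ x ∈ Ioo (p - r) (p + r), HasDerivAt φ (ψ x) x := by
    intro x hx
    apply intervalIntegral.integral_hasDerivAt_right
    · apply ContinuousOn.intervalIntegrable
      apply hψc.mono
      exact (convex_Ioo _ _).ordConnected.uIcc_subset hpU hx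
    · exact hψc.stronglyMeasurableAtFilter isOpen_Ioo x hx
    · exact hψc.continuousAt (isOpen_Ioo.mem_nhds hx)
  have hφp : φ p = 0 := by simp [hφ]
  have hψrec : ∀ x ∈ Ioo (p - r) (p + r), ψ (h x) * deriv h x = deriv h p * ψ x := by
    intro x hx
    simp only [hψ]
    rw [hSrec x hx, Real.exp_add]
    simp only [hL]
    rw [Real.exp_sub, Real.exp_log (hpos x), Real.exp_log (hpos p)]
    have := (hpos p).ne'
    field_simp
  refine ⟨r, φ, ψ, hr0, hrle, hpos p, hlt, hmaps, hφd, ?_, ?_, ?_, hψc, ?_, hφp⟩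
  · intro x hx
    have h1 := (abs_le.1 (hSb x hx)).1
    calc (1 / 2 : ℝ) = Real.exp (-Real.log 2) := by
          rw [Real.exp_neg, Real.exp_log two_pos]; norm_num
      _ ≤ _ := Real.exp_le_exp.2 h1
  · intro x hx
    have h1 := (abs_le.1 (hSb x hx)).2
    calc ψ x ≤ Real.exp (Real.log 2) := Real.exp_le_exp.2 h1
      _ = 2 := Real.exp_log two_pos
  · intro x hx
    have hder : ∀ z ∈ Ioo (p - r) (p + r),
        HasDerivWithinAt (fun z => φ (h z) - deriv h p * φ z) 0 (Ioo (p - r) (p + r)) z := by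
      intro z hz
      have h1 := (hφd (h z) (hmaps z hz)).comp z (hdiff z).hasDerivAt
      have h2 := h1.sub ((hφd z hz).const_mul (deriv h p))
      rw [hψrec z hz, sub_self] at h2
      exact h2.hasDerivWithinAt
    have := Convex.norm_image_sub_le_of_norm_hasDerivWithin_le (C := 0) hder
      (fun z _ => by simp) (convex_Ioo _ _) hpU hx
    rw [zero_mul, norm_le_zero_iff, hp, hφp] at this
    linarith
  · simp only [hψ, hSp, Real.exp_zero]

namespace Koenigs
variable {h : ℝ → ℝ} {p lam r : ℝ} {φ ψ : ℝ → ℝ}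

lemma p_mem (k : Koenigs h p lam r φ ψ) : p ∈ Ioo (p - r) (p + r) := ⟨by linarith [k.r_pos], by linarith [k.r_pos]⟩

lemma lower (k : Koenigs h p lam r φ ψ) {x y : ℝ} (hx : x ∈ Ioo (p - r) (p + r)) (hy : y ∈ Ioo (p - r) (p + r))
    (hxy : x ≤ y) : 1 / 2 * (y - x) ≤ φ y - φ x := mvt_lower k.deriv_phi k.psi_ge hx hy hxy

lemma upper (k : Koenigs h p lam r φ ψ) {x y : ℝ} (hx : x ∈ Ioo (p - r) (p + r)) (hy : y ∈ Ioo (p - r) (p + r))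
    (hxy : x ≤ y) : φ y - φ x ≤ 2 * (y - x) := mvt_upper k.deriv_phi k.psi_le hx hy hxy

lemma strictMonoOn (k : Koenigs h p lam r φ ψ) : StrictMonoOn φ (Ioo (p - r) (p + r)) := by
  intro x hx y hy hxy
  have := k.lower hx hy hxy.le
  linarith

lemma abs_lower (k : Koenigs h p lam r φ ψ) {x : ℝ} (hx : x ∈ Ioo (p - r) (p + r)) : |x - p| ≤ 2 * |φ x| := by
  rcases le_total p x with hle | hle
  · have := k.lower k.p_mem hx hle
    rw [k.phi_p] at this
    rw [abs_of_nonneg (by linarith), abs_of_nonneg (by linarith)]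
    linarith
  · have := k.lower hx k.p_mem hle
    rw [k.phi_p] at this
    rw [abs_of_nonpos (by linarith), abs_of_nonpos (by linarith)]
    linarith

lemma abs_upper (k : Koenigs h p lam r φ ψ) {x : ℝ} (hx : x ∈ Ioo (p - r) (p + r)) : |φ x| ≤ 2 * |x - p| := by
  rcases le_total p x with hle | hle
  · have h1 := k.lower k.p_mem hx hle
    have := k.upper k.p_mem hx hle
    rw [k.phi_p] at this h1
    rw [abs_of_nonneg (by linarith), abs_of_nonneg (by linarith)]
    linarith
  · have h1 := k.lower hx k.p_mem hle
    have := k.upper hx k.p_mem hle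
    rw [k.phi_p] at this h1
    rw [abs_of_nonpos (by linarith), abs_of_nonpos (by linarith)]
    linarith

lemma phi_pos (k : Koenigs h p lam r φ ψ) {x : ℝ} (hx : x ∈ Ioo p (p + r)) : 0 < φ x := by
  have := k.strictMonoOn k.p_mem ⟨by linarith [hx.1, k.r_pos], hx.2⟩ hx.1
  rwa [k.phi_p] at this

lemma pos_of_phi_pos (k : Koenigs h p lam r φ ψ) {x : ℝ} (hx : x ∈ Ioo (p - r) (p + r)) (h : 0 < φ x) :
    x ∈ Ioo p (p + r) := by
  refine ⟨?_, hx.2⟩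
  rw [← k.phi_p] at h
  exact (k.strictMonoOn.lt_iff_lt k.p_mem hx).1 h

lemma iter (k : Koenigs h p lam r φ ψ) (n : ℕ) {x : ℝ} (hx : x ∈ Ioo (p - r) (p + r)) :
    h^[n] x ∈ Ioo (p - r) (p + r) ∧ φ (h^[n] x) = lam ^ n * φ x := by
  induction n with
  | zero => exact ⟨hx, by simp⟩
  | succ n ih =>
    rw [Function.iterate_succ_apply']
    exact ⟨k.maps _ ih.1, by rw [k.conj _ ih.1, ih.2]; ring⟩

lemma exists_phi_eq (k : Koenigs h p lam r φ ψ) {s : ℝ} (hs : |s| < r / 2) : ∃ z ∈ Ioo (p - r) (p + r), φ z = s := by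
  rw [abs_lt] at hs
  obtain ⟨q, hq1, hq2⟩ := exists_between (show max (2 * |s|) 0 < r by
    apply max_lt _ k.r_pos
    have := abs_lt.2 hs
    linarith)
  have hq0 : 0 ≤ q := (le_max_right _ _).trans hq1.le
  have hqs : 2 * |s| ≤ q := (le_max_left _ _).trans hq1.le
  have m1 : p - q ∈ Ioo (p - r) (p + r) := ⟨by linarith, by linarith⟩
  have m2 : p + q ∈ Ioo (p - r) (p + r) := ⟨by linarith, by linarith⟩
  have l1 := k.lower m1 k.p_mem (by linarith)
  have l2 := k.lower k.p_mem m2 (by linarith)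
  rw [k.phi_p] at l1 l2
  have hcont : ContinuousOn φ (Icc (p - q) (p + q)) := by
    intro z hz
    exact (k.deriv_phi z ⟨by linarith [hz.1], by linarith [hz.2]⟩).continuousAt.continuousWithinAt
  have habs := abs_le.1 (le_refl |s|)
  obtain ⟨z, hz, hzs⟩ := intermediate_value_Icc (by linarith) hcont
    (show s ∈ _ from ⟨by linarith, by linarith⟩)
  exact ⟨z, ⟨by linarith [hz.1], by linarith [hz.2]⟩, hzs⟩

lemma zoom (k : Koenigs h p lam r φ ψ) (n : ℕ) {y s : ℝ} (hy : y ∈ Ioo (p - r) (p + r)) (hs : |s| < r / 2)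
    (hys : φ y = lam ^ n * s) : ∃ z ∈ Ioo (p - r) (p + r), φ z = s ∧ h^[n] z = y := by
  obtain ⟨z, hz, hzs⟩ := k.exists_phi_eq hs
  refine ⟨z, hz, hzs, ?_⟩
  obtain ⟨i1, i2⟩ := k.iter n hz
  apply k.strictMonoOn.injOn i1 hy
  rw [i2, hys, hzs]

end Koenigs
/-! ### Euler scheme -/

/-- `G` contains elements which in the coordinate `T` are close to small translations of sign `σ`,
up to relative error `η`. -/
def NearTrans (G : Subgroup CircleDeg1Liftˣ) (a b : ℝ) (T : ℝ → ℝ) (U : Set ℝ) (σ η : ℝ) : Prop :=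
  ∃ g ∈ G, ∃ ε : ℝ, 0 < ε ∧ ε < η ∧ ∀ x ∈ Ioo a b, g x ∈ U ∧ |T (g x) - T x - σ * ε| ≤ η * ε

lemma NearTrans.mono {G : Subgroup CircleDeg1Liftˣ} {a b : ℝ} {T : ℝ → ℝ} {U : Set ℝ} {σ η η' : ℝ}
    (h : NearTrans G a b T U σ η) (hle : η ≤ η') : NearTrans G a b T U σ η' := by
  obtain ⟨g, hg, ε, h0, h1, h2⟩ := h
  refine ⟨g, hg, ε, h0, h1.trans_le hle, fun x hx => ⟨(h2 x hx).1, (h2 x hx).2.trans ?_⟩⟩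
  exact mul_le_mul_of_nonneg_right hle h0.le

lemma nearTrans_pigeon {G : Subgroup CircleDeg1Liftˣ} {a b : ℝ} {T : ℝ → ℝ} {U : Set ℝ} {η0 : ℝ}
    (hη0 : 0 < η0)
    (h : ∀ η > 0, η ≤ η0 → ∃ σ : ℝ, (σ = 1 ∨ σ = -1) ∧ NearTrans G a b T U σ η) :
    ∃ σ : ℝ, (σ = 1 ∨ σ = -1) ∧ ∀ η > 0, NearTrans G a b T U σ η := by
  by_cases hp : ∀ η > 0, NearTrans G a b T U 1 η
  · exact ⟨1, Or.inl rfl, hp⟩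
  · push Not at hp
    obtain ⟨η1, h1, hn⟩ := hp
    refine ⟨-1, Or.inr rfl, fun η hη => ?_⟩
    obtain ⟨σ, hσ, hN⟩ := h (min η (min η1 η0)) (lt_min hη (lt_min h1 hη0))
      ((min_le_right _ _).trans (min_le_right _ _))
    rcases hσ with rfl | rfl
    · exact absurd (hN.mono ((min_le_right _ _).trans (min_le_left _ _))) hn
    · exact hN.mono (min_le_left _ _)

lemma euler {G : Subgroup CircleDeg1Liftˣ} {a b σ κ : ℝ} {T τ : ℝ → ℝ} {U : Set ℝ}
    (hσ : σ = 1 ∨ σ = -1) (hκ : 0 < κ) (hU : Ioo a b ⊆ U) (hT : StrictMonoOn T U)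
    (hd : ∀ x ∈ Ioo a b, HasDerivAt T (τ x) x) (hτ : ∀ x ∈ Ioo a b, κ ≤ τ x)
    (H : ∀ η > 0, NearTrans G a b T U σ η)
    {c d t0 : ℝ} (hac : a < c) (hcd : c ≤ d) (hdb : d < b) (ht0 : 0 < t0) {Φ : ℝ → ℝ → ℝ}
    (hΦ : IsLocalFlowOn (fun x => σ / τ x) (Ioo a b) Φ (Icc c d) t0) {e : ℝ} (he : 0 < e) :
    ∃ g ∈ G, ∀ x ∈ Icc c d, |g x - Φ t0 x| < e := by
  obtain ⟨hΦ0, hΦ⟩ := hΦ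
  have htt : t0 ∈ Icc (0 : ℝ) t0 := ⟨ht0.le, le_refl _⟩
  have hflow : ∀ x ∈ Icc c d, T (Φ t0 x) = T x + σ * t0 := by
    intro x hx
    have key : ∀ t ∈ Icc (0 : ℝ) t0,
        HasDerivWithinAt (fun s => T (Φ s x) - σ * s) 0 (Icc (0 : ℝ) t0) t := by
      intro t ht
      obtain ⟨m, hdt⟩ := hΦ x hx t ht
      have h1 := (hd _ m).comp_hasDerivWithinAt t hdt
      have h2 := h1.sub ((hasDerivWithinAt_id t (Icc (0 : ℝ) t0)).const_mul σ)
      have hne : τ (Φ t x) ≠ 0 := (hκ.trans_le (hτ _ m)).ne'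
      have : τ (Φ t x) * (σ / τ (Φ t x)) - σ * 1 = 0 := by
        field_simp; ring
      rw [this] at h2
      exact h2
    have := Convex.norm_image_sub_le_of_norm_hasDerivWithin_le (C := 0) key
      (fun t _ => by simp) (convex_Icc _ _) (⟨le_refl _, ht0.le⟩ : (0:ℝ) ∈ Icc (0:ℝ) t0) htt
    rw [zero_mul, norm_le_zero_iff] at this
    have h0 := hΦ0 x hx
    simp only [h0] at this
    linarith
  have hc : c ∈ Icc c d := ⟨le_refl _, hcd⟩
  have hdm : d ∈ Icc c d := ⟨hcd, le_refl _⟩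
  have hsub : Icc c d ⊆ Ioo a b := fun x hx => ⟨hac.trans_le hx.1, hx.2.trans_lt hdb⟩
  have mc := (hΦ c hc t0 htt).1
  have md := (hΦ d hdm t0 htt).1
  set cs := min c (Φ t0 c) with hcs
  set ds := max d (Φ t0 d) with hds
  have hcsm : cs ∈ Ioo a b := by
    rcases min_choice c (Φ t0 c) with h | h <;> rw [hcs, h]
    · exact hsub hc
    · exact mc
  have hdsm : ds ∈ Ioo a b := by
    rcases max_choice d (Φ t0 d) with h | h <;> rw [hds, h]
    · exact hsub hdm
    · exact md
  have hTm : MonotoneOn T (Ioo a b) := (hT.mono hU).monotoneOn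
  have r1 : ∀ x ∈ Icc c d, ∀ s, 0 ≤ s → s ≤ t0 → T cs ≤ T x + σ * s ∧ T x + σ * s ≤ T ds := by
    intro x hx s hs0 hs1
    have e1 : T cs ≤ T c := hTm hcsm (hsub hc) (min_le_left _ _)
    have e2 : T cs ≤ T (Φ t0 c) := hTm hcsm mc (min_le_right _ _)
    have e3 : T d ≤ T ds := hTm (hsub hdm) hdsm (le_max_left _ _)
    have e4 : T (Φ t0 d) ≤ T ds := hTm md hdsm (le_max_right _ _)
    have e5 : T c ≤ T x := hTm (hsub hc) (hsub hx) hx.1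
    have e6 : T x ≤ T d := hTm (hsub hx) (hsub hdm) hx.2
    rw [hflow c hc] at e2
    rw [hflow d hdm] at e4
    rcases hσ with rfl | rfl <;> constructor <;> linarith
  set c2 := (a + cs) / 2 with hc2
  set d2 := (ds + b) / 2 with hd2
  have hc2m : c2 ∈ Ioo a b := ⟨by linarith [hcsm.1], by linarith [hcsm.1, hcsm.2]⟩
  have hd2m : d2 ∈ Ioo a b := ⟨by linarith [hdsm.1, hdsm.2], by linarith [hdsm.2]⟩
  have q1 : T c2 < T cs := hT (hU hc2m) (hU hcsm) (by linarith [hcsm.1])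
  have q2 : T ds < T d2 := hT (hU hdsm) (hU hd2m) (by linarith [hdsm.2])
  set m := min (T cs - T c2) (T d2 - T ds) with hm
  have hm0 : 0 < m := lt_min (by linarith) (by linarith)
  have hm1 : m ≤ T cs - T c2 := min_le_left _ _
  have hm2 : m ≤ T d2 - T ds := min_le_right _ _
  set η := min m (κ * e) / (2 * (t0 + 1)) with hη
  have hη0 : 0 < η := div_pos (lt_min hm0 (mul_pos hκ he)) (by linarith)
  have hηe : η * (t0 + 1) = min m (κ * e) / 2 := by
    rw [hη]; field_simp
  have hηm : η * (t0 + 1) < m := by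
    rw [hηe]; have := min_le_left m (κ * e); linarith
  have hηκ : η * (t0 + 1) < κ * e := by
    rw [hηe]; have := min_le_right m (κ * e); have := mul_pos hκ he; linarith
  obtain ⟨g, hg, ε, hε0, hεη, hgε⟩ := H η hη0
  set n := ⌊t0 / ε⌋₊ with hn
  have hn1 : (n : ℝ) * ε ≤ t0 := by
    rw [← le_div_iff₀ hε0]; exact Nat.floor_le (div_nonneg ht0.le hε0.le)
  have hn2 : t0 < (n + 1) * ε := by
    rw [← div_lt_iff₀ hε0]; exact Nat.lt_floor_add_one _
  have ind : ∀ x ∈ Icc c d, ∀ k : ℕ, k ≤ n →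
      (g : CircleDeg1Lift)^[k] x ∈ Ioo a b ∧
        |T ((g : CircleDeg1Lift)^[k] x) - T x - σ * (k * ε)| ≤ η * (k * ε) := by
    intro x hx k
    induction k with
    | zero => intro _; exact ⟨hsub hx, by simp⟩
    | succ k ih =>
      intro hk
      obtain ⟨i1, i2⟩ := ih (by omega)
      obtain ⟨j1, j2⟩ := hgε _ i1
      rw [Function.iterate_succ_apply']
      have hk' : ((k + 1 : ℕ) : ℝ) * ε ≤ t0 := by
        refine le_trans ?_ hn1
        apply mul_le_mul_of_nonneg_right _ hε0.le
        exact_mod_cast hk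
      have hk0 : 0 ≤ ((k + 1 : ℕ) : ℝ) * ε := by positivity
      have B : |T (g ((g : CircleDeg1Lift)^[k] x)) - T x - σ * ((k + 1 : ℕ) * ε)|
          ≤ η * ((k + 1 : ℕ) * ε) := by
        have e1 : T (g ((g : CircleDeg1Lift)^[k] x)) - T x - σ * ((k + 1 : ℕ) * ε) =
          (T (g ((g : CircleDeg1Lift)^[k] x)) - T ((g : CircleDeg1Lift)^[k] x) - σ * ε) +
          (T ((g : CircleDeg1Lift)^[k] x) - T x - σ * (k * ε)) := by
          push_cast; ring
        have e2 : η * ((k + 1 : ℕ) * ε) = η * ε + η * (k * ε) := by push_cast; ring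
        rw [e1, e2]
        exact (abs_add_le _ _).trans (add_le_add j2 i2)
      refine ⟨?_, B⟩
      have B2 : η * ((k + 1 : ℕ) * ε) ≤ η * t0 := mul_le_mul_of_nonneg_left hk' hη0.le
      obtain ⟨w1, w2⟩ := r1 x hx _ hk0 hk'
      obtain ⟨b1, b2⟩ := abs_le.1 B
      have l1 : c2 < g ((g : CircleDeg1Lift)^[k] x) := by
        rw [← hT.lt_iff_lt (hU hc2m) j1]; linarith
      have l2 : g ((g : CircleDeg1Lift)^[k] x) < d2 := by
        rw [← hT.lt_iff_lt j1 (hU hd2m)]; linarith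
      exact ⟨hc2m.1.trans l1, l2.trans hd2m.2⟩
  refine ⟨g ^ n, G.pow_mem hg n, fun x hx => ?_⟩
  rw [cu_pow_apply]
  obtain ⟨i1, i2⟩ := ind x hx n le_rfl
  have mx := (hΦ x hx t0 htt).1
  have hTT : |T ((g : CircleDeg1Lift)^[n] x) - T (Φ t0 x)| < κ * e := by
    rw [hflow x hx]
    have e1 : T ((g : CircleDeg1Lift)^[n] x) - (T x + σ * t0) =
      (T ((g : CircleDeg1Lift)^[n] x) - T x - σ * (n * ε)) + σ * (n * ε - t0) := by ring
    have e2 : |σ * (n * ε - t0)| ≤ η := by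
      have : |σ| = 1 := by rcases hσ with rfl | rfl <;> simp
      rw [abs_mul, this, one_mul, abs_le]
      constructor <;> linarith
    rw [e1]
    have := abs_add_le (T ((g : CircleDeg1Lift)^[n] x) - T x - σ * (n * ε)) (σ * (n * ε - t0))
    have : η * (n * ε) ≤ η * t0 := mul_le_mul_of_nonneg_left hn1 hη0.le
    linarith
  obtain ⟨t1, t2⟩ := abs_lt.1 hTT
  rw [abs_lt]
  rcases le_total ((g : CircleDeg1Lift)^[n] x) (Φ t0 x) with hle | hle
  · have := mvt_lower hd hτ i1 mx hle
    have h3 : κ * (Φ t0 x - (g : CircleDeg1Lift)^[n] x) < κ * e := by linarith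
    have := lt_of_mul_lt_mul_left h3 hκ.le
    constructor <;> linarith
  · have := mvt_lower hd hτ mx i1 hle
    have h3 : κ * ((g : CircleDeg1Lift)^[n] x - Φ t0 x) < κ * e := by linarith
    have := lt_of_mul_lt_mul_left h3 hκ.le
    constructor <;> linarith

lemma euler_closure {Γ : Subgroup (S1 ≃ₜ S1)} {a b σ κ : ℝ} {T τ : ℝ → ℝ} {U : Set ℝ}
    (hσ : σ = 1 ∨ σ = -1) (hκ : 0 < κ) (hab : a < b) (hab1 : b ≤ a + 1)
    (hU : Ioo a b ⊆ U) (hT : StrictMonoOn T U)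
    (hd : ∀ x ∈ Ioo a b, HasDerivAt T (τ x) x) (hτ : ∀ x ∈ Ioo a b, κ ≤ τ x)
    (hτc : ContinuousOn τ (Ioo a b))
    (H : ∀ η > 0, NearTrans (liftGroup Γ) a b T U σ η) :
    ∃ a b : ℝ, a < b ∧ b ≤ a + 1 ∧
      ∃ X : ℝ → ℝ, ContinuousOn X (Ioo a b) ∧ (∀ x ∈ Ioo a b, X x ≠ 0) ∧
        InC0Closure Γ a b X := by
  have hne : ∀ x ∈ Ioo a b, τ x ≠ 0 := fun x hx => (hκ.trans_le (hτ x hx)).ne'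
  refine ⟨a, b, hab, hab1, fun x => σ / τ x, continuousOn_const.div hτc hne, fun x hx => ?_, ?_⟩
  · apply div_ne_zero _ (hne x hx)
    rcases hσ with rfl | rfl <;> norm_num
  · intro c d hac hcd hdb t0 ht0 Φ hΦ
    have : ∀ n : ℕ, ∃ g ∈ liftGroup Γ, ∀ x ∈ Icc c d, |g x - Φ t0 x| < 1 / ((n : ℝ) + 1) :=
      fun n => euler hσ hκ hU hT hd hτ H hac hcd hdb ht0 hΦ (by positivity)
    choose g hg hg2 using this
    choose γ hγ hγ2 using hg
    refine ⟨γ, g, fun n => ⟨hγ n, hγ2 n⟩, ?_⟩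
    rw [Metric.tendstoUniformlyOn_iff]
    intro e he
    have := (tendsto_one_div_add_atTop_nhds_zero_nat (𝕜 := ℝ)).eventually (gt_mem_nhds he)
    filter_upwards [this] with n hn x hx
    rw [dist_comm, Real.dist_eq]
    exact (hg2 n x hx).trans hn

/-! ### Zooming in at a hyperbolic fixed point -/

lemma conj_apply (h f : CircleDeg1Liftˣ) (k : ℕ) {x z : ℝ}
    (hz : (h : CircleDeg1Lift)^[k] z = f ((h : CircleDeg1Lift)^[k] x)) :
    ((h ^ k)⁻¹ * f * h ^ k) x = z := by
  rw [cu_mul, cu_mul, cu_pow_apply, ← hz, ← cu_pow_apply]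
  exact CircleDeg1Lift.units_inv_apply_apply (h ^ k) z

lemma conj_mem {G : Subgroup CircleDeg1Liftˣ} {h f : CircleDeg1Liftˣ} (hh : h ∈ G) (hf : f ∈ G)
    (k : ℕ) : (h ^ k)⁻¹ * f * h ^ k ∈ G :=
  G.mul_mem (G.mul_mem (G.inv_mem (G.pow_mem hh k)) hf) (G.pow_mem hh k)

lemma case1_disp {h : ℝ → ℝ} {p lam r : ℝ} {φ ψ : ℝ → ℝ} (k : Koenigs h p lam r φ ψ)
    {δ1 : ℝ} (hδ1 : 0 < δ1) : ∃ δ > 0, ∀ f : ℝ → ℝ, Differentiable ℝ f →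
      (∀ x, |f x - x| < δ ∧ |deriv f x - 1| < δ) →
      |φ (f p)| ≤ δ1 ∧ ∀ y, |y - p| ≤ r / 2 → f y ∈ Ioo (p - r) (p + r) ∧
        |(φ (f y) - φ y) - φ (f p)| ≤ δ1 * |y - p| := by
  have hr := k.r_pos
  have hK : Icc (p - 3 / 4 * r) (p + 3 / 4 * r) ⊆ Ioo (p - r) (p + r) := fun x hx =>
    ⟨by linarith [hx.1], by linarith [hx.2]⟩
  have huc := isCompact_Icc.uniformContinuousOn_of_continuous (k.psi_cont.mono hK)
  rw [Metric.uniformContinuousOn_iff] at huc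
  obtain ⟨δu, hδu, hu⟩ := huc (δ1 / 2) (by linarith)
  refine ⟨min (r / 4) (min (δ1 / 4) δu), lt_min (by linarith) (lt_min (by linarith) hδu), ?_⟩
  intro f hf hclose
  have c1 : ∀ x, |f x - x| < r / 4 := fun x => (hclose x).1.trans_le (min_le_left _ _)
  have c2 : ∀ x, |f x - x| < δ1 / 4 := fun x =>
    (hclose x).1.trans_le ((min_le_right _ _).trans (min_le_left _ _))
  have c3 : ∀ x, |f x - x| < δu := fun x =>
    (hclose x).1.trans_le ((min_le_right _ _).trans (min_le_right _ _))
  have c4 : ∀ x, |deriv f x - 1| < δ1 / 4 := fun x =>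
    (hclose x).2.trans_le ((min_le_right _ _).trans (min_le_left _ _))
  have mem1 : ∀ y ∈ Icc (p - r / 2) (p + r / 2), f y ∈ Icc (p - 3 / 4 * r) (p + 3 / 4 * r) := by
    intro y hy
    have := abs_lt.1 (c1 y)
    exact ⟨by linarith [hy.1], by linarith [hy.2]⟩
  have mem2 : ∀ y ∈ Icc (p - r / 2) (p + r / 2), y ∈ Icc (p - 3 / 4 * r) (p + 3 / 4 * r) :=
    fun y hy => ⟨by linarith [hy.1], by linarith [hy.2]⟩
  have pm : p ∈ Icc (p - r / 2) (p + r / 2) := ⟨by linarith, by linarith⟩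
  constructor
  · have := k.abs_upper (hK (mem1 p pm))
    have := c2 p
    linarith
  · intro y hy
    have ym : y ∈ Icc (p - r / 2) (p + r / 2) := by
      rw [abs_le] at hy; exact ⟨by linarith, by linarith⟩
    refine ⟨hK (mem1 y ym), ?_⟩
    have hD : ∀ z ∈ Icc (p - r / 2) (p + r / 2), HasDerivWithinAt (fun z => φ (f z) - φ z)
        (ψ (f z) * deriv f z - ψ z) (Icc (p - r / 2) (p + r / 2)) z := by
      intro z hz
      have h1 := (k.deriv_phi _ (hK (mem1 z hz))).comp z (hf z).hasDerivAt
      exact (h1.sub (k.deriv_phi _ (hK (mem2 z hz)))).hasDerivWithinAt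
    have hB : ∀ z ∈ Icc (p - r / 2) (p + r / 2), ‖ψ (f z) * deriv f z - ψ z‖ ≤ δ1 := by
      intro z hz
      have e1 : ψ (f z) * deriv f z - ψ z = ψ (f z) * (deriv f z - 1) + (ψ (f z) - ψ z) := by ring
      have e2 : |ψ (f z) - ψ z| < δ1 / 2 := by
        rw [← Real.dist_eq]
        exact hu _ (mem1 z hz) _ (mem2 z hz) (by rw [Real.dist_eq]; exact c3 z)
      have e3 : |ψ (f z) * (deriv f z - 1)| ≤ 2 * (δ1 / 4) := by
        rw [abs_mul]
        apply mul_le_mul _ (c4 z).le (abs_nonneg _) (by norm_num)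
        rw [abs_of_nonneg (by linarith [k.psi_ge _ (hK (mem1 z hz))])]
        exact k.psi_le _ (hK (mem1 z hz))
      rw [e1, Real.norm_eq_abs]
      have := abs_add_le (ψ (f z) * (deriv f z - 1)) (ψ (f z) - ψ z)
      linarith
    have := Convex.norm_image_sub_le_of_norm_hasDerivWithin_le hD hB (convex_Icc _ _) pm ym
    simpa [k.phi_p, Real.norm_eq_abs] using this

lemma case1 {G : Subgroup CircleDeg1Liftˣ} {h : CircleDeg1Liftˣ} (hh : h ∈ G) (hgood : GoodGroup G)
    {p lam r : ℝ} {φ ψ : ℝ → ℝ} (k : Koenigs h p lam r φ ψ)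
    (Hf : ∀ δ > 0, ∃ f ∈ G, f p ≠ p ∧ ∀ x, |f x - x| < δ ∧ |deriv f x - 1| < δ) :
    ∃ σ : ℝ, (σ = 1 ∨ σ = -1) ∧ ∀ η > 0,
      NearTrans G (p - r / 8) (p + r / 8) φ (Ioo (p - r) (p + r)) σ η := by
  have hr := k.r_pos
  have hr1 := k.r_le
  have hl := k.lam_pos
  have hl1 := k.lam_lt
  apply nearTrans_pigeon (η0 := r / 16) (by linarith)
  intro η hη hηr
  have hη1 : η ≤ 1 := by linarith
  have hδ1 : 0 < η * (lam * (η / 2)) := by positivity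
  obtain ⟨δ, hδ, hδf⟩ := case1_disp k hδ1
  obtain ⟨f, hf, hfp, hfδ⟩ := Hf δ hδ
  have hfd : Differentiable ℝ f := fun x => ((hgood f hf).1 x (mem_univ x)).differentiableAt
  obtain ⟨u1, u2⟩ := hδf f hfd hfδ
  have hfpm := (u2 p (by simp; linarith)).1
  have hD0 : φ (f p) ≠ 0 := by
    intro h0
    rw [← k.phi_p] at h0
    exact hfp (k.strictMonoOn.injOn hfpm k.p_mem h0)
  have hDpos : 0 < |φ (f p)| := abs_pos.2 hD0
  have hDle : |φ (f p)| ≤ η / 2 := by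
    refine u1.trans ?_
    have : η * lam ≤ 1 := by nlinarith
    nlinarith
  obtain ⟨n, n1, n2⟩ := exists_nat_pow_near_of_lt_one (x := |φ (f p)| / (η / 2)) (y := lam)
    (by positivity) (by rw [div_le_one (by linarith)]; exact hDle) hl hl1
  rw [lt_div_iff₀ (by linarith)] at n1
  rw [div_le_iff₀ (by linarith)] at n2
  have hln : 0 < lam ^ n := by positivity
  set ε := |φ (f p)| / lam ^ n with hε
  have hε0 : 0 < ε := by positivity
  have hε1 : ε ≤ η / 2 := by
    rw [hε, div_le_iff₀ hln]; linarith
  have hε2 : lam * (η / 2) ≤ ε := by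
    rw [hε, le_div_iff₀ hln]
    calc lam * (η / 2) * lam ^ n = lam ^ (n + 1) * (η / 2) := by ring
      _ ≤ _ := n1.le
  obtain ⟨σ, hσ, hσD⟩ : ∃ σ : ℝ, (σ = 1 ∨ σ = -1) ∧ φ (f p) = σ * |φ (f p)| := by
    rcases lt_or_gt_of_ne hD0 with h | h
    · exact ⟨-1, Or.inr rfl, by rw [abs_of_neg h]; ring⟩
    · exact ⟨1, Or.inl rfl, by rw [abs_of_pos h]; ring⟩
  have hσε : σ * ε = φ (f p) / lam ^ n := by
    rw [hε, hσD, ← mul_div_assoc]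
    congr 2
    rw [← hσD]
  refine ⟨σ, hσ, _, conj_mem hh hf n, ε, hε0, by linarith, ?_⟩
  intro x hx
  have hxU : x ∈ Ioo (p - r) (p + r) := ⟨by linarith [hx.1], by linarith [hx.2]⟩
  obtain ⟨i1, i2⟩ := k.iter n hxU
  set y := (h : CircleDeg1Lift)^[n] x with hy
  have hxp : |x - p| ≤ r / 8 := by rw [abs_le]; exact ⟨by linarith [hx.1], by linarith [hx.2]⟩
  have hφx : |φ x| ≤ r / 4 := by have := k.abs_upper hxU; linarith
  have hyp : |y - p| ≤ lam ^ n * (r / 2) := by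
    have := k.abs_lower i1
    rw [i2, abs_mul, abs_of_pos hln] at this
    have := mul_le_mul_of_nonneg_left hφx hln.le
    linarith
  have hln1 : lam ^ n ≤ 1 := pow_le_one₀ hl.le hl1.le
  obtain ⟨v1, v2⟩ := u2 y (by nlinarith)
  set s := φ (f y) / lam ^ n with hs
  have hs2 : |s - φ x - σ * ε| ≤ η * ε := by
    have e1 : s - φ x - σ * ε = ((φ (f y) - φ y) - φ (f p)) / lam ^ n := by
      rw [hσε, hs, i2]; field_simp
    rw [e1, abs_div, abs_of_pos hln, div_le_iff₀ hln]
    refine v2.trans ?_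
    calc η * (lam * (η / 2)) * |y - p| ≤ η * (lam * (η / 2)) * (lam ^ n * 1) := by
          apply mul_le_mul_of_nonneg_left _ hδ1.le
          refine hyp.trans (mul_le_mul_of_nonneg_left (by linarith) hln.le)
      _ = (η * (lam * (η / 2))) * lam ^ n := by ring
      _ ≤ η * ε * lam ^ n := by
          apply mul_le_mul_of_nonneg_right _ hln.le
          exact mul_le_mul_of_nonneg_left hε2 hη.le
  have hs3 : |s| < r / 2 := by
    have e1 : s = (s - φ x - σ * ε) + φ x + σ * ε := by ring
    have e2 : |σ * ε| = ε := by
      rw [abs_mul, abs_of_pos hε0]; rcases hσ with rfl | rfl <;> simp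
    have e3 : η * ε ≤ 1 * ε := mul_le_mul_of_nonneg_right hη1 hε0.le
    rw [e1]
    have := abs_add_le (s - φ x - σ * ε + φ x) (σ * ε)
    have := abs_add_le (s - φ x - σ * ε) (φ x)
    linarith
  obtain ⟨z, hz1, hz2, hz3⟩ := k.zoom n v1 hs3 (by rw [hs]; field_simp)
  rw [conj_apply h f n hz3, hz2]
  exact ⟨hz1, hs2⟩

lemma zoom_right {h : CircleDeg1Liftˣ} {p lam r : ℝ} {φ ψ : ℝ → ℝ} (k : Koenigs h p lam r φ ψ)
    (f : CircleDeg1Liftˣ) {P : ℝ → Prop} (hP : ∀ᶠ y in 𝓝[>] p, P y)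
    (h1 : ∀ᶠ y in 𝓝[>] p, f y ∈ Ioo (p - r) (p + r) ∧ 0 < φ (f y) ∧ φ (f y) < 2 * φ y) :
    ∃ N : ℕ, ∀ n ≥ N, ∀ x ∈ Ioo (p + r / 16) (p + r / 8), ∃ y z, P y ∧ 0 < φ x ∧ 0 < φ z ∧
      ((h ^ n)⁻¹ * f * h ^ n) x = z ∧ z ∈ Ioo p (p + r) ∧
      φ y = lam ^ n * φ x ∧ φ (f y) = lam ^ n * φ z := by
  have hr := k.r_pos
  have hr1 := k.r_le
  have hl := k.lam_pos
  have hl1 := k.lam_lt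
  obtain ⟨u, hu, hsub⟩ := mem_nhdsGT_iff_exists_Ioo_subset.1 (hP.and h1)
  have hu' : 0 < u - p := sub_pos.2 hu
  have := (tendsto_pow_atTop_nhds_zero_of_lt_one hl.le hl1).eventually (gt_mem_nhds hu')
  obtain ⟨N, hN⟩ := eventually_atTop.1 this
  refine ⟨N, fun n hn x hx => ?_⟩
  have hln : 0 < lam ^ n := by positivity
  have hx0 : x ∈ Ioo p (p + r) := ⟨by linarith [hx.1], by linarith [hx.2]⟩
  have hxU : x ∈ Ioo (p - r) (p + r) := ⟨by linarith [hx.1], by linarith [hx.2]⟩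
  have hφx := k.phi_pos hx0
  have hφx2 : φ x < r / 4 := by
    have := k.abs_upper hxU
    rw [abs_of_pos hφx, abs_of_pos (by linarith [hx0.1])] at this
    linarith [hx.2]
  obtain ⟨i1, i2⟩ := k.iter n hxU
  set y := (h : CircleDeg1Lift)^[n] x with hy
  have hφy : 0 < φ y := by rw [i2]; positivity
  have hy0 := k.pos_of_phi_pos i1 hφy
  have hyu : y ∈ Ioo p u := by
    refine ⟨hy0.1, ?_⟩
    have := k.abs_lower i1
    rw [abs_of_pos hφy, abs_of_pos (by linarith [hy0.1]), i2] at this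
    have : lam ^ n * φ x ≤ lam ^ n * (1 / 4) := mul_le_mul_of_nonneg_left (by linarith) hln.le
    have := hN n hn
    linarith
  obtain ⟨py, m1, m2, m3⟩ := hsub hyu
  have hs : |φ (f y) / lam ^ n| < r / 2 := by
    rw [abs_of_pos (by positivity), div_lt_iff₀ hln]
    rw [i2] at m3
    nlinarith
  obtain ⟨z, hz1, hz2, hz3⟩ := k.zoom n m1 hs (by field_simp)
  have hφz : 0 < φ z := by rw [hz2]; positivity
  refine ⟨y, z, py, hφx, hφz, conj_apply h f n hz3, k.pos_of_phi_pos hz1 hφz, i2, ?_⟩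
  rw [hz2]; field_simp

lemma ratio_tendsto {h : ℝ → ℝ} {p lam r : ℝ} {φ ψ : ℝ → ℝ} (k : Koenigs h p lam r φ ψ)
    {f : ℝ → ℝ} {μ : ℝ} (hfp : f p = p) (hf : HasDerivAt f μ p) :
    Tendsto (fun y => φ (f y) / φ y) (𝓝[>] p) (𝓝 μ) := by
  have hφ := k.deriv_phi p k.p_mem
  rw [k.psi_p] at hφ
  have hφf : HasDerivAt (fun y => φ (f y)) (1 * μ) p :=
    HasDerivAt.comp p (by rw [hfp]; exact hφ) hf
  have hle : 𝓝[>] p ≤ 𝓝[≠] p := nhdsWithin_mono p (fun x hx => ne_of_gt hx)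
  have t1 := (hasDerivAt_iff_tendsto_slope.1 hφ).mono_left hle
  have t2 := (hasDerivAt_iff_tendsto_slope.1 hφf).mono_left hle
  have t3 := t2.div t1 one_ne_zero
  rw [one_mul, div_one] at t3
  refine t3.congr' ?_
  filter_upwards [self_mem_nhdsWithin] with y hy
  have : y - p ≠ 0 := sub_ne_zero.2 (ne_of_gt hy)
  simp only [Pi.div_apply, slope_def_field, hfp, k.phi_p, sub_zero]
  field_simp

lemma near_right {h : ℝ → ℝ} {p lam r : ℝ} {φ ψ : ℝ → ℝ} (k : Koenigs h p lam r φ ψ)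
    {f : ℝ → ℝ} {μ : ℝ} (hfp : f p = p) (hf : HasDerivAt f μ p) (hμ0 : 0 < μ) (hμ2 : μ < 2) :
    ∀ᶠ y in 𝓝[>] p, f y ∈ Ioo (p - r) (p + r) ∧ 0 < φ (f y) ∧ φ (f y) < 2 * φ y := by
  have hr := k.r_pos
  have t := ratio_tendsto k hfp hf
  have e1 := t.eventually (lt_mem_nhds hμ0)
  have e2 := t.eventually (gt_mem_nhds hμ2)
  have e3 : ∀ᶠ y in 𝓝[>] p, f y ∈ Ioo (p - r) (p + r) := by
    have : Tendsto f (𝓝[>] p) (𝓝 p) := by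
      have := hf.continuousAt.tendsto
      rw [hfp] at this
      exact this.mono_left nhdsWithin_le_nhds
    exact this.eventually (Ioo_mem_nhds (by linarith) (by linarith))
  have e4 : ∀ᶠ y in 𝓝[>] p, y ∈ Ioo p (p + r) := Ioo_mem_nhdsGT (by linarith)
  filter_upwards [e1, e2, e3, e4] with y h1 h2 h3 h4
  have := k.phi_pos h4
  rw [div_lt_iff₀ this] at h2
  exact ⟨h3, (div_pos_iff_of_pos_right this).1 h1, h2⟩

lemma case2 {G : Subgroup CircleDeg1Liftˣ} {h : CircleDeg1Liftˣ} (hh : h ∈ G) (hgood : GoodGroup G)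
    {p lam r : ℝ} {φ ψ : ℝ → ℝ} (k : Koenigs h p lam r φ ψ)
    (Hf : ∀ δ > 0, ∃ f ∈ G, f p = p ∧ deriv f p ≠ 1 ∧ |deriv f p - 1| < δ) :
    ∃ σ : ℝ, (σ = 1 ∨ σ = -1) ∧ ∀ η > 0,
      NearTrans G (p + r / 16) (p + r / 8) (fun x => Real.log (φ x)) (Ioo p (p + r)) σ η := by
  apply nearTrans_pigeon (η0 := 1) one_pos
  intro η hη _
  obtain ⟨δ, hδ, hlog⟩ : ∃ δ > 0, ∀ μ : ℝ, |μ - 1| < δ → |Real.log μ| < η := by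
    have := Metric.continuousAt_iff.1 (Real.continuousAt_log one_ne_zero) η hη
    obtain ⟨δ, hδ, h⟩ := this
    refine ⟨δ, hδ, fun μ hμ => ?_⟩
    have := h (by rw [Real.dist_eq]; exact hμ)
    simpa [Real.dist_eq] using this
  obtain ⟨f, hf, hfp, hf1, hfδ⟩ := Hf (min δ 1) (lt_min hδ one_pos)
  set μ := deriv f p with hμ
  have hμ0 : 0 < μ := (hgood f hf).2 p
  have hμ2 : μ < 2 := by
    have := abs_lt.1 (hfδ.trans_le (min_le_right _ _)); linarith
  have hε := hlog μ (hfδ.trans_le (min_le_left _ _))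
  have hl0 : Real.log μ ≠ 0 := by
    apply Real.log_ne_zero_of_pos_of_ne_one hμ0 hf1
  have hεp : 0 < |Real.log μ| := abs_pos.2 hl0
  have hfd : HasDerivAt f μ p := ((hgood f hf).1 p (mem_univ p)).differentiableAt.hasDerivAt
  obtain ⟨σ, hσ, hσD⟩ : ∃ σ : ℝ, (σ = 1 ∨ σ = -1) ∧ Real.log μ = σ * |Real.log μ| := by
    rcases lt_or_gt_of_ne hl0 with h | h
    · exact ⟨-1, Or.inr rfl, by rw [abs_of_neg h]; ring⟩
    · exact ⟨1, Or.inl rfl, by rw [abs_of_pos h]; ring⟩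
  have t := (Real.continuousAt_log hμ0.ne').tendsto.comp (ratio_tendsto k hfp hfd)
  have ev := Metric.tendsto_nhds.1 t (η * |Real.log μ|) (by positivity)
  obtain ⟨N, hN⟩ := zoom_right k f ev (near_right k hfp hfd hμ0 hμ2)
  refine ⟨σ, hσ, _, conj_mem hh hf N, |Real.log μ|, hεp, hε, fun x hx => ?_⟩
  obtain ⟨y, z, p1, hx0, hz0, hgz, hzm, e1, e2⟩ := hN N le_rfl x hx
  rw [hgz]
  refine ⟨hzm, ?_⟩
  have hln : 0 < lam ^ N := pow_pos k.lam_pos N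
  rw [← hσD]
  simp only [Function.comp, Real.dist_eq, e1, e2] at p1
  rw [mul_div_mul_left _ _ hln.ne', Real.log_div hz0.ne' hx0.ne'] at p1
  exact p1.le

lemma exists_order {f : ℝ → ℝ} (hf : AnalyticOnNhd ℝ f univ) {p : ℝ} (hfp : f p = p)
    (hd : deriv f p = 1) (hne : ∃ x, f x ≠ x) :
    ∃ (j : ℕ) (u : ℝ → ℝ), 1 ≤ j ∧ ContinuousAt u p ∧ u p ≠ 0 ∧
      ∀ᶠ x in 𝓝 p, f x - x = (x - p) ^ (j + 1) * u x := by
  have hg : AnalyticAt ℝ (fun x => f x - x) p := (hf p (mem_univ p)).sub analyticAt_id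
  have hnz : ¬ ∀ᶠ x in 𝓝 p, f x - x = 0 := by
    intro hz
    obtain ⟨x, hx⟩ := hne
    apply hx
    have : f = id := hf.eq_of_eventuallyEq (fun x _ => analyticAt_id)
      (hz.mono fun x hx => by simp only [id]; linarith)
    rw [this]; rfl
  obtain ⟨n, u, hu, hup, hev⟩ := hg.exists_eventuallyEq_pow_smul_nonzero_iff.2 hnz
  simp only [smul_eq_mul] at hev
  have hn0 : n ≠ 0 := by
    rintro rfl
    have := hev.self_of_nhds
    simp [hfp] at this
    exact hup this.symm
  have hn1 : n ≠ 1 := by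
    rintro rfl
    have h1 : HasDerivAt (fun x => f x - x) (1 - 1) p := by
      rw [← hd]
      nth_rewrite 2 [hd]
      exact (hf p (mem_univ p)).differentiableAt.hasDerivAt.sub (hasDerivAt_id p)
    have h2 : HasDerivAt (fun x => (x - p) ^ 1 * u x) (1 * u p + (p - p) * deriv u p) p := by
      simp only [pow_one]
      exact ((hasDerivAt_id p).sub_const p).mul hu.differentiableAt.hasDerivAt
    have h3 := h2.congr_of_eventuallyEq hev
    have := h1.unique h3
    simp at this
    exact hup this.symm
  obtain ⟨j, rfl⟩ : ∃ j, n = j + 1 := ⟨n - 1, by omega⟩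
  exact ⟨j, u, by omega, hu.continuousAt, hup, hev⟩

lemma case3_tendsto {h : ℝ → ℝ} {p lam r : ℝ} {φ ψ : ℝ → ℝ} (k : Koenigs h p lam r φ ψ)
    {f u : ℝ → ℝ} {j : ℕ} (hfp : f p = p) (hfd : HasDerivAt f 1 p) (hu : ContinuousAt u p)
    (hev : ∀ᶠ x in 𝓝 p, f x - x = (x - p) ^ (j + 1) * u x) :
    Tendsto (fun y => -(φ (f y) ^ j)⁻¹ - -(φ y ^ j)⁻¹) (𝓝[>] p) (𝓝 (j * u p)) := by
  have hr := k.r_pos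
  have hU : Ioo (p - r) (p + r) ∈ 𝓝 p := Ioo_mem_nhds (by linarith) (by linarith)
  have hstr : HasStrictDerivAt φ 1 p := by
    rw [← k.psi_p]
    apply hasStrictDerivAt_of_hasDerivAt_of_continuousAt
    · filter_upwards [hU] with x hx using k.deriv_phi x hx
    · exact k.psi_cont.continuousAt hU
  have tf : Tendsto f (𝓝[>] p) (𝓝 p) := by
    have := hfd.continuousAt.tendsto
    rw [hfp] at this
    exact this.mono_left nhdsWithin_le_nhds
  have tid : Tendsto (fun y : ℝ => y) (𝓝[>] p) (𝓝 p) := nhdsWithin_le_nhds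
  have hpos : ∀ᶠ y in 𝓝[>] p, y ∈ Ioo p (p + r) := Ioo_mem_nhdsGT (by linarith)
  have hev' : ∀ᶠ x in 𝓝[>] p, f x - x = (x - p) ^ (j + 1) * u x := hev.filter_mono nhdsWithin_le_nhds
  have tu : Tendsto u (𝓝[>] p) (𝓝 (u p)) := hu.tendsto.mono_left nhdsWithin_le_nhds
  have t0 : Tendsto (fun y => (f y - y) / (y - p) ^ (j + 1)) (𝓝[>] p) (𝓝 (u p)) := by
    refine tu.congr' ?_
    filter_upwards [hev', hpos] with y h1 h2
    have : y - p ≠ 0 := (sub_pos.2 h2.1).ne'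
    rw [h1]; field_simp
  have lo : (fun y => φ (f y) - φ y - (f y - y)) =o[𝓝[>] p] (fun y => (y - p) ^ (j + 1)) := by
    have l1 := (hasStrictDerivAt_iff_hasStrictFDerivAt.1 hstr).isLittleO.comp_tendsto
      (tf.prodMk_nhds tid)
    have l2 : (fun y => f y - y) =O[𝓝[>] p] (fun y => (y - p) ^ (j + 1)) := by
      have l3 : (fun y => (y - p) ^ (j + 1) * u y) =O[𝓝[>] p] (fun y => (y - p) ^ (j + 1) * 1) :=
        (Asymptotics.isBigO_refl _ _).mul (tu.isBigO_one ℝ)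
      simp only [mul_one] at l3
      exact l3.congr' (hev'.mono fun y hy => hy.symm) (Eventually.of_forall fun _ => rfl)
    refine (l1.congr (fun y => ?_) (fun y => rfl)).trans_isBigO l2
    simp
  have t1 : Tendsto (fun y => (φ (f y) - φ y) / (y - p) ^ (j + 1)) (𝓝[>] p) (𝓝 (u p)) := by
    have := lo.tendsto_div_nhds_zero.add t0
    rw [zero_add] at this
    refine this.congr (fun y => ?_)
    rw [← add_div]; congr 1; ring
  have t2 : Tendsto (fun y => φ y / (y - p)) (𝓝[>] p) (𝓝 1) := by
    have hle : 𝓝[>] p ≤ 𝓝[≠] p := nhdsWithin_mono p (fun x hx => ne_of_gt hx)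
    have := (hasDerivAt_iff_tendsto_slope.1 hstr.hasDerivAt).mono_left hle
    refine this.congr (fun y => ?_)
    rw [slope_def_field, k.phi_p, sub_zero]
  have t3 := ratio_tendsto k hfp hfd
  have t4 : Tendsto (fun y => ∑ i ∈ Finset.range j, (φ (f y) / φ y) ^ i) (𝓝[>] p) (𝓝 j) := by
    have := tendsto_finsetSum (Finset.range j) (fun i _ => t3.pow i)
    simpa using this
  have t5 := ((t1.div (t2.pow (j + 1)) (by simp)).mul t4).div (t3.pow j) (by simp)
  simp only [one_pow, div_one] at t5
  rw [mul_comm]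
  refine t5.congr' ?_
  have hnr := near_right k hfp hfd one_pos (by norm_num)
  filter_upwards [hpos, hnr] with y h1 h2
  have hB := k.phi_pos h1
  have hA := h2.2.1
  have hyp : y - p ≠ 0 := (sub_pos.2 h1.1).ne'
  have hg := mul_geom_sum (φ (f y) / φ y) j
  have hg2 : (∑ i ∈ Finset.range j, (φ (f y) / φ y) ^ i) * (φ (f y) - φ y)
      = φ y * ((φ (f y) / φ y) ^ j - 1) := by
    rw [← hg]; field_simp
  simp only [Pi.div_apply]
  have : (φ (f y) - φ y) / (y - p) ^ (j + 1) / (φ y / (y - p)) ^ (j + 1) =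
      (φ (f y) - φ y) / φ y ^ (j + 1) := by
    rw [div_pow]; field_simp
  rw [this, div_mul_eq_mul_div, mul_comm (φ (f y) - φ y), hg2, div_pow, pow_succ]
  field_simp
  ring

lemma case3 {G : Subgroup CircleDeg1Liftˣ} {h : CircleDeg1Liftˣ} (hh : h ∈ G) (hgood : GoodGroup G)
    {p lam r : ℝ} {φ ψ : ℝ → ℝ} (k : Koenigs h p lam r φ ψ)
    {f : CircleDeg1Liftˣ} (hf : f ∈ G) (hfp : f p = p) (hd : deriv f p = 1) (hne : ∃ x, f x ≠ x) :
    ∃ j : ℕ, 1 ≤ j ∧ ∃ σ : ℝ, (σ = 1 ∨ σ = -1) ∧ ∀ η > 0,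
      NearTrans G (p + r / 16) (p + r / 8) (fun x => -(φ x ^ j)⁻¹) (Ioo p (p + r)) σ η := by
  obtain ⟨j, u, hj, hu, hup, hev⟩ := exists_order (hgood f hf).1 hfp hd hne
  have hfd : HasDerivAt f 1 p := by
    rw [← hd]; exact ((hgood f hf).1 p (mem_univ p)).differentiableAt.hasDerivAt
  obtain ⟨σ, hσ, hσD⟩ : ∃ σ : ℝ, (σ = 1 ∨ σ = -1) ∧ u p = σ * |u p| := by
    rcases lt_or_gt_of_ne hup with h | h
    · exact ⟨-1, Or.inr rfl, by rw [abs_of_neg h]; ring⟩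
    · exact ⟨1, Or.inl rfl, by rw [abs_of_pos h]; ring⟩
  refine ⟨j, hj, σ, hσ, fun η hη => ?_⟩
  have hj0 : (0 : ℝ) < j := by exact_mod_cast hj
  have hup' : 0 < |u p| := abs_pos.2 hup
  have hc : 0 < j * |u p| := by positivity
  have t := case3_tendsto k hfp hfd hu hev
  have ev := Metric.tendsto_nhds.1 t (η * (j * |u p|)) (by positivity)
  obtain ⟨N, hN⟩ := zoom_right k f ev (near_right k hfp hfd one_pos (by norm_num))
  have hl := k.lam_pos
  have hl1 := k.lam_lt
  have ts := (tendsto_pow_atTop_nhds_zero_of_lt_one hl.le hl1).eventually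
    (gt_mem_nhds (show 0 < η / (j * |u p|) by positivity))
  obtain ⟨M, hM⟩ := eventually_atTop.1 ts
  set n := max N M with hn
  have hln : 0 < lam ^ n := pow_pos hl n
  have hln1 : lam ^ n ≤ 1 := pow_le_one₀ hl.le hl1.le
  have hq : (lam ^ n) ^ j ≤ lam ^ n := by
    calc (lam ^ n) ^ j ≤ (lam ^ n) ^ 1 := pow_le_pow_of_le_one hln.le hln1 hj
      _ = _ := pow_one _
  set q := (lam ^ n) ^ j with hqd
  have hq0 : 0 < q := by positivity
  refine ⟨_, conj_mem hh hf n, q * (j * |u p|), by positivity, ?_, fun x hx => ?_⟩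
  · have := hM n (le_max_right _ _)
    rw [← lt_div_iff₀ hc]
    linarith
  · obtain ⟨y, z, p1, hx0, hz0, hgz, hzm, e1, e2⟩ := hN n (le_max_left _ _) x hx
    rw [hgz]
    refine ⟨hzm, ?_⟩
    simp only [Real.dist_eq, e1, e2] at p1
    have e3 : -(φ z ^ j)⁻¹ - -(φ x ^ j)⁻¹ - σ * (q * (j * |u p|)) =
        q * (-((lam ^ n * φ z) ^ j)⁻¹ - -((lam ^ n * φ x) ^ j)⁻¹ - j * u p) := by
      rw [mul_pow, mul_pow, ← hqd]
      have e4 : σ * (q * (j * |u p|)) = q * (j * u p) := by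
        calc σ * (q * (j * |u p|)) = q * (j * (σ * |u p|)) := by ring
          _ = _ := by rw [← hσD]
      rw [e4]
      field_simp
    rw [e3, abs_mul, abs_of_pos hq0]
    calc _ ≤ q * (η * (j * |u p|)) := mul_le_mul_of_nonneg_left p1.le hq0.le
      _ = _ := by ring

/-! ### Assembly -/

lemma goodGroup_liftGroup {Γ : Subgroup (S1 ≃ₜ S1)} (hΓ : ∀ f ∈ Γ, IsAnalyticDiffeo f) :
    GoodGroup (liftGroup Γ) := by
  rintro F ⟨f, hf, hF⟩
  obtain ⟨F', hF', hA, hD⟩ := hΓ f hf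
  have key : ∀ x : ℝ, ∃ m : ℤ, (m : ℝ) = F x - F' x := by
    intro x
    have h1 : ((F x : ℝ) : S1) = ((F' x : ℝ) : S1) := by rw [← hF, ← hF']
    have h2 : (F x : ℝ) - F' x ∈ AddSubgroup.zmultiples (1 : ℝ) :=
      QuotientAddGroup.eq_iff_sub_mem.1 h1
    obtain ⟨m, hm⟩ := AddSubgroup.mem_zmultiples_iff.1 h2
    exact ⟨m, by rw [← hm]; simp⟩
  choose m hm using key
  have hc : Continuous m := by
    rw [Int.isClosedEmbedding_coe_real.isEmbedding.continuous_iff]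
    have : ((fun n : ℤ => (n : ℝ)) ∘ m) = fun x => F x - F' x := funext hm
    rw [this]
    exact (cu_continuous F).sub (cu_continuous F')
  have hconst : ∀ x, m x = m 0 := fun x => PreconnectedSpace.constant inferInstance hc
  have hE : (⇑(F : CircleDeg1Lift)) = fun x => (F' : CircleDeg1Lift) x + (m 0 : ℝ) := by
    funext x
    have := hm x
    rw [hconst x] at this
    linarith
  rw [hE]
  refine ⟨fun x hx => (hA x hx).add analyticAt_const, fun x => ?_⟩
  rw [deriv_add_const]
  exact hD x

lemma tau_facts {h : ℝ → ℝ} {p lam r : ℝ} {φ ψ : ℝ → ℝ} (k : Koenigs h p lam r φ ψ) {x : ℝ}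
    (hx : x ∈ Ioo (p + r / 16) (p + r / 8)) : x ∈ Ioo (p - r) (p + r) ∧ 0 < φ x ∧ φ x ≤ 1 := by
  have hr := k.r_pos
  have hr1 := k.r_le
  have hxU : x ∈ Ioo (p - r) (p + r) := ⟨by linarith [hx.1], by linarith [hx.2]⟩
  have h0 : 0 < φ x := k.phi_pos ⟨by linarith [hx.1], by linarith [hx.2]⟩
  refine ⟨hxU, h0, ?_⟩
  have := k.abs_upper hxU
  rw [abs_of_pos h0, abs_of_pos (by linarith [hx.1])] at this
  linarith [hx.2]

/-- (Proposition 3.9 of the paper.) A subgroup of `Diff^ω₊(S¹)` which is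
nondiscrete in the `C¹`-topology and preserves no Borel probability measure admits a nowhere
zero continuous local vector field on some open interval of the circle which is in the
`C⁰`-closure of `Γ` relative to that interval. -/
theorem exists_vector_field_in_C0_closure
    (Γ : Subgroup (S1 ≃ₜ S1)) (hΓ : ∀ f ∈ Γ, IsAnalyticDiffeo f)
    (hnd : C1Nondiscrete Γ) (hmeas : ¬ HasInvariantProbMeasure Γ) :
    ∃ a b : ℝ, a < b ∧ b ≤ a + 1 ∧
      ∃ X : ℝ → ℝ, ContinuousOn X (Ioo a b) ∧ (∀ x ∈ Ioo a b, X x ≠ 0) ∧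
        InC0Closure Γ a b X := by

  have hgood := goodGroup_liftGroup hΓ
  have hcf : ¬ CommonFix (liftGroup Γ) := fun hG => hmeas
    (hasInvariantProbMeasure_of_commonFix Γ
      (fun f hf => let ⟨F, hF, _⟩ := hΓ f hf; ⟨F, hF⟩) hG)
  obtain ⟨h, hh, p, hp, hlt⟩ := exists_hyperbolic hcf hgood
  obtain ⟨r, φ, ψ, k⟩ := exists_koenigs (hgood h hh).1 (hgood h hh).2 hp hlt
  have hr := k.r_pos
  have hr1 := k.r_le
  obtain ⟨f, F, hfF, hconv⟩ := hnd
  have hFG : ∀ n, F n ∈ liftGroup Γ := fun n => ⟨f n, (hfF n).1, (hfF n).2.2⟩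
  have hU2 : Ioo (p + r / 16) (p + r / 8) ⊆ Ioo p (p + r) := fun x hx =>
    ⟨by linarith [hx.1], by linarith [hx.2]⟩
  have hUU : Ioo p (p + r) ⊆ Ioo (p - r) (p + r) := fun x hx => ⟨by linarith [hx.1], hx.2⟩
  have hcontφ : ContinuousOn φ (Ioo (p + r / 16) (p + r / 8)) := fun x hx =>
    (k.deriv_phi x (tau_facts k hx).1).continuousAt.continuousWithinAt
  have hcontψ : ContinuousOn ψ (Ioo (p + r / 16) (p + r / 8)) :=
    k.psi_cont.mono (hU2.trans hUU)
  by_cases hC1 : ∀ N, ∃ n ≥ N, F n p ≠ p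
  · -- case 1
    obtain ⟨σ, hσ, H⟩ := case1 hh hgood k (fun δ hδ => by
      obtain ⟨N, hN⟩ := hconv δ hδ
      obtain ⟨n, hn, hne⟩ := hC1 N
      exact ⟨F n, hFG n, hne, hN n hn⟩)
    have hsub : Ioo (p - r / 8) (p + r / 8) ⊆ Ioo (p - r) (p + r) := fun x hx =>
      ⟨by linarith [hx.1], by linarith [hx.2]⟩
    exact euler_closure hσ (κ := 1 / 2) (by norm_num) (by linarith) (by linarith) hsub
      k.strictMonoOn (fun x hx => k.deriv_phi x (hsub hx)) (fun x hx => k.psi_ge x (hsub hx))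
      (k.psi_cont.mono hsub) H
  push Not at hC1
  obtain ⟨N0, hN0⟩ := hC1
  by_cases hC3 : ∃ n ≥ N0, deriv (F n) p = 1
  · -- case 3
    obtain ⟨n, hn, hd⟩ := hC3
    have hne : ∃ x, F n x ≠ x := by
      by_contra hcon
      push Not at hcon
      apply (hfF n).2.1
      apply Homeomorph.ext
      intro x
      obtain ⟨y, rfl⟩ := QuotientAddGroup.mk_surjective x
      have := (hfF n).2.2 y
      rw [hcon y] at this
      exact this
    obtain ⟨j, hj, σ, hσ, H⟩ := case3 hh hgood k (hFG n) (hN0 n hn) hd hne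
    refine euler_closure hσ (κ := 1 / 2) (τ := fun x => j * ψ x / φ x ^ (j + 1))
      (by norm_num) (by linarith) (by linarith) hU2 ?_ ?_ ?_ ?_ H
    · intro x hx y hy hxy
      have h1 := k.phi_pos hx
      have h2 := k.strictMonoOn (hUU hx) (hUU hy) hxy
      have h3 : φ x ^ j < φ y ^ j := pow_lt_pow_left₀ h2 h1.le (by omega)
      have h4 := inv_strictAnti₀ (pow_pos h1 j) h3
      simpa using h4
    · intro x hx
      obtain ⟨m, h0, h1⟩ := tau_facts k hx
      have hd := (((k.deriv_phi x m).pow j).inv (pow_ne_zero j h0.ne')).neg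
      refine hd.congr_deriv ?_
      obtain ⟨i, rfl⟩ : ∃ i, j = i + 1 := ⟨j - 1, by omega⟩
      simp only [Nat.add_sub_cancel, Pi.pow_apply]
      field_simp
      ring
    · intro x hx
      obtain ⟨m, h0, h1⟩ := tau_facts k hx
      have hψ := k.psi_ge x m
      have hj0 : (1 : ℝ) ≤ j := by exact_mod_cast hj
      have hpw : φ x ^ (j + 1) ≤ 1 := pow_le_one₀ h0.le h1
      rw [le_div_iff₀ (by positivity)]
      nlinarith
    · apply (continuousOn_const.mul hcontψ).div (hcontφ.pow _)
      intro x hx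
      exact pow_ne_zero _ (tau_facts k hx).2.1.ne'
  · -- case 2
    push Not at hC3
    obtain ⟨σ, hσ, H⟩ := case2 hh hgood k (fun δ hδ => by
      obtain ⟨N, hN⟩ := hconv δ hδ
      exact ⟨F (max N N0), hFG _, hN0 _ (le_max_right _ _), hC3 _ (le_max_right _ _),
        (hN _ (le_max_left _ _) p).2⟩)
    refine euler_closure hσ (κ := 1 / 2) (τ := fun x => ψ x / φ x)
      (by norm_num) (by linarith) (by linarith) hU2 ?_ ?_ ?_ ?_ H
    · intro x hx y hy hxy
      exact Real.log_lt_log (k.phi_pos hx) (k.strictMonoOn (hUU hx) (hUU hy) hxy)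
    · intro x hx
      obtain ⟨m, h0, h1⟩ := tau_facts k hx
      exact (k.deriv_phi x m).log h0.ne'
    · intro x hx
      obtain ⟨m, h0, h1⟩ := tau_facts k hx
      have hψ := k.psi_ge x m
      rw [le_div_iff₀ h0]
      nlinarith
    · apply hcontψ.div hcontφ
      intro x hx
      exact (tau_facts k hx).2.1.ne'


end
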